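/- arXiv:1405.4105 — 7 statements merged into one kernel-verified Lean document; each statement's English description precedes it below -/
import Mathlib

section
/- Let k be a field and let H be a Hopf algebra over k whose underlying algebra is commutative. Then H is a noetherian ring if and only if H is an affine k-algebra, i.e. finitely generated as a k-algebra. -/
namespace MolnarAux
open TensorProduct Coalgebra HopfAlgebra

variable {k H : Type*} [Field k] [CommRing H] [HopfAlgebra k H]

/-- The subspace `p ⊗ q` of `H ⊗ H`. -/
noncomputable def T2 (p q : Submodule k H) : Submodule k (H ⊗[k] H) :=
  Submodule.map₂ (TensorProduct.mk k H H) p q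

lemma T2_tmul {p q : Submodule k H} {a b : H} (ha : a ∈ p) (hb : b ∈ q) : a ⊗ₜ[k] b ∈ T2 p q :=
  Submodule.apply_mem_map₂ _ ha hb

lemma T2_le {p q : Submodule k H} {r : Submodule k (H ⊗[k] H)}
    (h : ∀ a ∈ p, ∀ b ∈ q, a ⊗ₜ[k] b ∈ r) : T2 p q ≤ r :=
  Submodule.map₂_le.2 h

lemma T2_mono {p q p' q' : Submodule k H} (h : p ≤ p') (h' : q ≤ q') : T2 p q ≤ T2 p' q' :=
  Submodule.map₂_le_map₂ h h'

lemma T2_map {N : Type*} [AddCommGroup N] [Module k N] {p q : Submodule k H}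
    (f : H ⊗[k] H →ₗ[k] N) (r : Submodule k N)
    (h : ∀ a ∈ p, ∀ b ∈ q, f (a ⊗ₜ[k] b) ∈ r) {x : H ⊗[k] H} (hx : x ∈ T2 p q) : f x ∈ r :=
  (T2_le (r := r.comap f) h) hx

lemma T2_mul {p q p' q' p'' q'' : Submodule k H} (hp : ∀ a ∈ p, ∀ b ∈ p', a * b ∈ p'')
    (hq : ∀ a ∈ q, ∀ b ∈ q', a * b ∈ q'') {x y : H ⊗[k] H} (hx : x ∈ T2 p q) (hy : y ∈ T2 p' q') :
    x * y ∈ T2 p'' q'' := by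
  refine T2_map (LinearMap.mulRight k y) _ (fun a ha b hb => ?_) hx
  rw [LinearMap.mulRight_apply]
  refine T2_map (LinearMap.mulLeft k (a ⊗ₜ[k] b)) _ (fun a' ha' b' hb' => ?_) hy
  rw [LinearMap.mulLeft_apply, Algebra.TensorProduct.tmul_mul_tmul]
  exact T2_tmul (hp _ ha _ ha') (hq _ hb _ hb')

/-- Right coideal. -/
def RC (V : Submodule k H) : Prop := ∀ v ∈ V, (comul v : H ⊗[k] H) ∈ T2 V ⊤

lemma RC_sup {V W : Submodule k H} (hV : RC V) (hW : RC W) : RC (V ⊔ W) := by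
  intro v hv
  have : V ⊔ W ≤ (T2 (V ⊔ W) ⊤).comap (comul : H →ₗ[k] H ⊗[k] H) :=
    sup_le (fun x hx => T2_mono le_sup_left le_rfl (hV x hx))
      (fun x hx => T2_mono le_sup_right le_rfl (hW x hx))
  exact this hv

lemma exists_RC (h : H) : ∃ V : Submodule k H, V.FG ∧ h ∈ V ∧ RC V := by
  classical
  let E : Module.Dual k H →ₗ[k] H :=
    (TensorProduct.rid k H).toLinearMap ∘ₗ
      (LinearMap.applyₗ (comul h : H ⊗[k] H)) ∘ₗ (LinearMap.lTensorHom H)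
  have hE : ∀ f, E f = TensorProduct.rid k H (LinearMap.lTensor H f (comul h)) := fun f => rfl
  have hmem : (comul h : H ⊗[k] H) ∈ T2 (LinearMap.range E) ⊤ := by
    let β := Module.Basis.ofVectorSpace k H
    rw [← (equivFinsuppOfBasisRight (M := H) β).symm_apply_apply (comul h : H ⊗[k] H),
      equivFinsuppOfBasisRight_symm_apply]
    refine Submodule.sum_mem _ fun i _ => T2_tmul ?_ trivial
    rw [equivFinsuppOfBasisRight_apply]
    exact ⟨_, hE _⟩
  refine ⟨LinearMap.range E, ?_, ⟨counit, ?_⟩, ?_⟩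
  · obtain ⟨s, hs⟩ := TensorProduct.exists_finset (R := k) (comul h : H ⊗[k] H)
    have hle : LinearMap.range E ≤ Submodule.span k (s.image Prod.fst : Finset H) := by
      rintro _ ⟨f, rfl⟩
      rw [hE, hs, map_sum, map_sum]
      refine Submodule.sum_mem _ fun i hi => ?_
      simp only [LinearMap.lTensor_tmul, TensorProduct.rid_tmul]
      exact Submodule.smul_mem _ _ (Submodule.subset_span (by
        simpa using ⟨i.2, hi⟩))
    have := FiniteDimensional.span_finset k (s.image Prod.fst : Finset H)
    have := Submodule.finiteDimensional_of_le hle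
    exact Module.Finite.iff_fg.1 this
  · rw [hE, lTensor_counit_comul]; simp
  · rintro _ ⟨f, rfl⟩
    let g : H →ₗ[k] H := (TensorProduct.rid k H).toLinearMap ∘ₗ LinearMap.lTensor H f ∘ₗ comul
    have key : (comul (E f) : H ⊗[k] H) = LinearMap.lTensor H g (comul h) := by
      have h1 : LinearMap.lTensor H g (comul h : H ⊗[k] H) =
          LinearMap.lTensor H ((TensorProduct.rid k H).toLinearMap ∘ₗ LinearMap.lTensor H f)
            (LinearMap.lTensor H comul (comul h)) := by
        rw [← LinearMap.lTensor_comp_apply]; rfl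
      rw [h1, ← coassoc_apply, hE]
      generalize (comul h : H ⊗[k] H) = z
      induction z with
      | zero => simp
      | add x y hx hy => simp only [map_add, hx, hy]
      | tmul x y =>
        simp only [LinearMap.lTensor_tmul, LinearMap.rTensor_tmul, TensorProduct.rid_tmul, map_smul]
        generalize (comul x : H ⊗[k] H) = w
        induction w with
        | zero => simp
        | add x y hx hy => simp only [map_add, add_tmul, smul_add, hx, hy]
        | tmul a b => simp
    rw [key]
    exact T2_map _ _ (fun a ha b _ => by
      rw [LinearMap.lTensor_tmul]; exact T2_tmul ha trivial) hmem

lemma exists_RC_finset (s : Finset H) :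
    ∃ V : Submodule k H, V.FG ∧ (∀ h ∈ s, h ∈ V) ∧ RC V := by
  classical
  induction s using Finset.induction_on with
  | empty => exact ⟨⊥, Submodule.fg_bot, by simp, fun v hv => by
      rw [(Submodule.mem_bot k).1 hv, map_zero]; exact zero_mem _⟩
  | insert a s _ ih =>
    obtain ⟨V, h1, h2, h3⟩ := ih
    obtain ⟨W, g1, g2, g3⟩ := exists_RC (k := k) a
    refine ⟨V ⊔ W, h1.sup g1, ?_, RC_sup h3 g3⟩
    intro h hh
    rcases Finset.mem_insert.1 hh with rfl | hh
    · exact Submodule.mem_sup_right g2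
    · exact Submodule.mem_sup_left (h2 h hh)

lemma exists_matrix (h : H) : ∃ (n : ℕ) (t : Matrix (Fin n) (Fin n) H),
    (∀ i j, (comul (t i j) : H ⊗[k] H) = ∑ l, t i l ⊗ₜ[k] t l j) ∧
    (∀ i j, counit (R := k) (t i j) = (1 : Matrix (Fin n) (Fin n) k) i j) ∧
    h ∈ Submodule.span k (Set.range fun p : Fin n × Fin n => t p.1 p.2) := by
  classical
  obtain ⟨V, hfg, hV, hRC⟩ := exists_RC (k := k) h
  have : Module.Finite k V := Module.Finite.iff_fg.2 hfg
  let b := Module.finBasis k V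
  set n := Module.finrank k V
  have hφ : ∀ i : Fin n, ∃ φ : H →ₗ[k] k, ∀ j, φ (b j : H) = if i = j then 1 else 0 := by
    intro i
    obtain ⟨g, hg⟩ := LinearMap.exists_extend (b.coord i)
    refine ⟨g, fun j => ?_⟩
    have := LinearMap.congr_fun hg (b j)
    simpa [Finsupp.single_apply, eq_comm] using this
  choose φ hφ using hφ
  have hex : ∀ x ∈ T2 V ⊤, ∃ t : Fin n → H, x = ∑ i, (b i : H) ⊗ₜ[k] t i := by
    let L : (Fin n → H) →ₗ[k] H ⊗[k] H :=
      ∑ i, (TensorProduct.mk k H H (b i : H)) ∘ₗ LinearMap.proj i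
    have hL : ∀ t, L t = ∑ i, (b i : H) ⊗ₜ[k] t i := fun t => by simp [L]
    have : T2 V ⊤ ≤ LinearMap.range L := T2_le fun a ha y _ => by
      refine ⟨fun i => b.repr ⟨a, ha⟩ i • y, ?_⟩
      rw [hL]
      have h1 := congrArg (Subtype.val) (b.sum_repr ⟨a, ha⟩)
      simp only [Submodule.coe_sum, Submodule.coe_smul] at h1
      conv_rhs => rw [← h1]
      simp only [sum_tmul, tmul_smul, smul_tmul']
    intro x hx
    obtain ⟨t, ht⟩ := this hx
    exact ⟨t, by rw [← ht, hL]⟩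
  have hex' : ∀ j, ∃ t : Fin n → H, (comul (b j : H) : H ⊗[k] H) = ∑ i, (b i : H) ⊗ₜ[k] t i :=
    fun j => hex _ (hRC _ (b j).2)
  choose t' ht' using hex'
  refine ⟨n, Matrix.of fun i j => t' j i, ?_, ?_, ?_⟩
  · intro i j
    have h1 := coassoc_apply (R := k) (b j : H)
    rw [ht' j] at h1
    simp only [map_sum, LinearMap.rTensor_tmul, LinearMap.lTensor_tmul, ht', sum_tmul,
      TensorProduct.assoc_tmul] at h1
    have h2 := congrArg (fun z => TensorProduct.lid k (H ⊗[k] H)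
      (LinearMap.rTensor (H ⊗[k] H) (φ i) z)) h1
    simp only [map_sum, LinearMap.rTensor_tmul, TensorProduct.lid_tmul, hφ, ite_smul, one_smul,
      zero_smul, Finset.sum_ite_eq, Finset.mem_univ, if_true] at h2
    simpa using h2.symm
  · intro i j
    have h1 := lTensor_counit_comul (R := k) (b j : H)
    rw [ht' j] at h1
    have h2 := congrArg (fun z => TensorProduct.rid k k
      (LinearMap.rTensor k (φ i) z)) h1
    simpa [hφ, Matrix.one_apply] using h2
  · have hb : ∀ j, (b j : H) ∈ Submodule.span k
        (Set.range fun p : Fin n × Fin n => (Matrix.of fun i j => t' j i) p.1 p.2) := by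
      intro j
      have h1 := rTensor_counit_comul (R := k) (b j : H)
      rw [ht' j] at h1
      have h2 := congrArg (TensorProduct.lid k H) h1
      simp only [map_sum, LinearMap.rTensor_tmul, TensorProduct.lid_tmul, one_smul] at h2
      rw [← h2]
      exact Submodule.sum_mem _ fun i _ => Submodule.smul_mem _ _
        (Submodule.subset_span ⟨(i, j), rfl⟩)
    have h1 := congrArg (Subtype.val) (b.sum_repr ⟨h, hV⟩)
    simp only [Submodule.coe_sum, Submodule.coe_smul] at h1
    rw [← h1]
    exact Submodule.sum_mem _ fun i _ => Submodule.smul_mem _ _ (hb i)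

/-- Hopf subalgebra. -/
def Good (K : Subalgebra k H) : Prop :=
  (∀ x ∈ K, (comul x : H ⊗[k] H) ∈ T2 (Subalgebra.toSubmodule K) (Subalgebra.toSubmodule K)) ∧
  ∀ x ∈ K, antipode k x ∈ K

lemma good_adjoin (s : Set H)
    (h1 : ∀ x ∈ s, (comul x : H ⊗[k] H) ∈ T2 (Subalgebra.toSubmodule (Algebra.adjoin k s))
      (Subalgebra.toSubmodule (Algebra.adjoin k s)))
    (h2 : ∀ x ∈ s, antipode k x ∈ Algebra.adjoin k s) : Good (Algebra.adjoin k s) := by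
  constructor
  · intro x hx
    induction hx using Algebra.adjoin_induction with
    | mem x hx => exact h1 x hx
    | algebraMap r =>
      rw [Bialgebra.comul_algebraMap, Algebra.TensorProduct.algebraMap_apply]
      exact T2_tmul (Subalgebra.algebraMap_mem _ _) (Subalgebra.one_mem _)
    | add x y _ _ hx hy => rw [map_add]; exact add_mem hx hy
    | mul x y _ _ hx hy =>
      rw [Bialgebra.comul_mul]
      exact T2_mul (fun a ha b hb => Subalgebra.mul_mem _ ha hb)
        (fun a ha b hb => Subalgebra.mul_mem _ ha hb) hx hy
  · intro x hx
    have : Algebra.adjoin k s ≤ (Algebra.adjoin k s).comap (antipodeAlgHom k H) :=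
      Algebra.adjoin_le fun x hx => by
        simpa using h2 x hx
    simpa using this hx

lemma good_sup {K L : Subalgebra k H} (hK : Good K) (hL : Good L) : Good (K ⊔ L) := by
  have e : K ⊔ L = Algebra.adjoin k ((K : Set H) ∪ L) := by
    rw [Algebra.adjoin_union, Algebra.adjoin_eq, Algebra.adjoin_eq]
  have hKl : K ≤ Algebra.adjoin k ((K : Set H) ∪ L) := e ▸ le_sup_left
  have hLl : L ≤ Algebra.adjoin k ((K : Set H) ∪ L) := e ▸ le_sup_right
  rw [e]
  refine good_adjoin _ ?_ ?_
  · rintro x (hx | hx)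
    · exact T2_mono (fun y hy => hKl hy) (fun y hy => hKl hy) (hK.1 x hx)
    · exact T2_mono (fun y hy => hLl hy) (fun y hy => hLl hy) (hL.1 x hx)
  · rintro x (hx | hx)
    · exact hKl (hK.2 x hx)
    · exact hLl (hL.2 x hx)

lemma exists_good (h : H) : ∃ K : Subalgebra k H, K.FG ∧ Good K ∧ h ∈ K := by
  classical
  obtain ⟨n, t, h1, h2, h3⟩ := exists_matrix (k := k) h
  let S := antipodeAlgHom k H
  have hS : ∀ x, S x = antipode k x := fun x => rfl
  let u : Matrix (Fin n) (Fin n) H := t.map S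
  have hut : u * t = 1 := by
    ext i j
    have := mul_antipode_rTensor_comul_apply (R := k) (t i j)
    rw [h1, h2] at this
    simp only [map_sum, LinearMap.rTensor_tmul, LinearMap.mul'_apply] at this
    rw [Matrix.mul_apply]
    simp only [u, Matrix.map_apply, hS]
    rw [this]
    simp only [Matrix.one_apply]; split_ifs <;> simp
  have htu : t * u = 1 := mul_eq_one_comm.1 hut
  -- antipode of u
  have hSu : u.map S = t := by
    have : u.map S * t.map S = 1 := by
      rw [← Matrix.map_mul, hut]; simp
    calc u.map S = u.map S * (u * t) := by rw [hut, mul_one]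
      _ = t := by rw [← mul_assoc]; erw [this]; rw [one_mul]
  let D := Bialgebra.comulAlgHom k H
  have hD : ∀ x, D x = comul x := fun x => rfl
  let iL : H →ₐ[k] H ⊗[k] H := Algebra.TensorProduct.includeLeft
  let iR : H →ₐ[k] H ⊗[k] H := Algebra.TensorProduct.includeRight
  have hDt : t.map D = t.map iL * t.map iR := by
    ext i j
    simp [Matrix.mul_apply, hD, h1, iL, iR]
  have hDu : u.map D = u.map iR * u.map iL := by
    have e1 : u.map D * t.map D = 1 := by rw [← Matrix.map_mul, hut]; simp
    have e2 : t.map D * (u.map iR * u.map iL) = 1 := by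
      rw [hDt, mul_assoc, ← mul_assoc (t.map iR), ← Matrix.map_mul, htu]
      simp only [Matrix.map_one, map_zero, map_one, one_mul]
      rw [← Matrix.map_mul, htu]; simp
    exact left_inv_eq_right_inv e1 e2
  let s : Finset H := (Finset.univ.image fun p : Fin n × Fin n => t p.1 p.2) ∪
    (Finset.univ.image fun p : Fin n × Fin n => u p.1 p.2)
  have ht : ∀ i j, t i j ∈ Algebra.adjoin k (s : Set H) := fun i j =>
    Algebra.subset_adjoin (Finset.mem_coe.2 (Finset.mem_union_left _
      (Finset.mem_image.2 ⟨(i, j), Finset.mem_univ _, rfl⟩)))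
  have hu : ∀ i j, u i j ∈ Algebra.adjoin k (s : Set H) := fun i j =>
    Algebra.subset_adjoin (Finset.mem_coe.2 (Finset.mem_union_right _
      (Finset.mem_image.2 ⟨(i, j), Finset.mem_univ _, rfl⟩)))
  refine ⟨Algebra.adjoin k (s : Set H), Subalgebra.fg_adjoin_finset s, good_adjoin _ ?_ ?_, ?_⟩
  · intro x hx
    rcases Finset.mem_union.1 (Finset.mem_coe.1 hx) with hx | hx
    · obtain ⟨p, -, rfl⟩ := Finset.mem_image.1 hx
      rw [h1]
      exact Submodule.sum_mem _ fun l _ => T2_tmul (ht _ _) (ht _ _)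
    · obtain ⟨p, -, rfl⟩ := Finset.mem_image.1 hx
      have := congrFun (congrFun hDu p.1) p.2
      rw [Matrix.map_apply, hD, Matrix.mul_apply] at this
      rw [this]
      refine Submodule.sum_mem _ fun l _ => ?_
      simp only [Matrix.map_apply, iL, iR, Algebra.TensorProduct.includeLeft_apply,
        Algebra.TensorProduct.includeRight_apply, Algebra.TensorProduct.tmul_mul_tmul, one_mul,
        mul_one]
      exact T2_tmul (hu _ _) (hu _ _)
  · intro x hx
    rcases Finset.mem_union.1 (Finset.mem_coe.1 hx) with hx | hx
    · obtain ⟨p, -, rfl⟩ := Finset.mem_image.1 hx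
      exact hu p.1 p.2
    · obtain ⟨p, -, rfl⟩ := Finset.mem_image.1 hx
      have := congrFun (congrFun hSu p.1) p.2
      rw [Matrix.map_apply, hS] at this
      rw [this]
      exact ht _ _
  · have : Submodule.span k (Set.range fun p : Fin n × Fin n => t p.1 p.2) ≤
        Subalgebra.toSubmodule (Algebra.adjoin k (s : Set H)) := by
      rw [Submodule.span_le]
      rintro _ ⟨p, rfl⟩
      exact ht _ _
    exact this h3

lemma exists_good_finset (s : Finset H) :
    ∃ K : Subalgebra k H, K.FG ∧ Good K ∧ ∀ h ∈ s, h ∈ K := by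
  classical
  induction s using Finset.induction_on with
  | empty =>
    obtain ⟨K, h1, h2, _⟩ := exists_good (k := k) (0 : H)
    exact ⟨K, h1, h2, by simp⟩
  | insert a s _ ih =>
    obtain ⟨V, h1, h2, h3⟩ := ih
    obtain ⟨W, g1, g2, g3⟩ := exists_good (k := k) a
    refine ⟨V ⊔ W, h1.sup g1, good_sup h2 g2, ?_⟩
    intro h hh
    rcases Finset.mem_insert.1 hh with rfl | hh
    · exact (le_sup_right : W ≤ V ⊔ W) g3
    · exact (le_sup_left : V ≤ V ⊔ W) (h3 h hh)

/-- `x ⊗ y ↦ Δ(x) (1 ⊗ S y)`. -/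
noncomputable def Th : H ⊗[k] H →ₗ[k] H ⊗[k] H :=
  LinearMap.lTensor H (LinearMap.mul' k H ∘ₗ LinearMap.lTensor H (antipode k)) ∘ₗ
    (TensorProduct.assoc k H H H).toLinearMap ∘ₗ LinearMap.rTensor H comul

lemma Th_comul (x : H) : Th (comul x : H ⊗[k] H) = x ⊗ₜ[k] 1 := by
  simp only [Th, LinearMap.comp_apply, LinearEquiv.coe_coe]
  rw [coassoc_apply, ← LinearMap.lTensor_comp_apply, LinearMap.comp_assoc,
    HopfAlgebra.mul_antipode_lTensor_comul, LinearMap.lTensor_comp_apply, lTensor_counit_comul]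
  simp

lemma Th_tmul (x y : H) :
    Th (x ⊗ₜ[k] y) = (comul x : H ⊗[k] H) * ((1 : H) ⊗ₜ[k] antipode k y) := by
  simp only [Th, LinearMap.comp_apply, LinearEquiv.coe_coe, LinearMap.rTensor_tmul]
  generalize (comul x : H ⊗[k] H) = w
  induction w with
  | zero => simp
  | add x y hx hy => simp only [map_add, add_tmul, add_mul, hx, hy]
  | tmul a b => simp

lemma final {K : Subalgebra k H} (hK : Good K) {M : Submodule k H} (hM : RC M) (a : H)
    (ha : a ∈ K) (hε : counit (R := k) a = 1) (h : ∀ m ∈ M, a * m ∈ K) : ∀ m ∈ M, m ∈ K := by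
  intro m hm
  have hz : (comul a : H ⊗[k] H) * (m ⊗ₜ[k] 1) ∈ T2 (Subalgebra.toSubmodule K) ⊤ := by
    rw [← Th_comul]
    refine T2_map (LinearMap.mulLeft k (comul a : H ⊗[k] H) ∘ₗ Th) _ (fun x hx y _ => ?_) (hM m hm)
    rw [LinearMap.comp_apply, Th_tmul, LinearMap.mulLeft_apply, ← mul_assoc,
      ← Bialgebra.comul_mul]
    exact T2_mul (q'' := ⊤) (fun a ha b hb => Subalgebra.mul_mem _ ha hb) (fun _ _ _ _ => trivial)
      (hK.1 _ (h x hx)) (T2_tmul (p := Subalgebra.toSubmodule K) (q := ⊤)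
        (Subalgebra.one_mem K) trivial)
  obtain ⟨p, hp⟩ := LinearMap.exists_leftInverse_of_injective
    (Subalgebra.toSubmodule K).subtype (Submodule.ker_subtype _)
  let L : H ⊗[k] H →ₗ[k] H := LinearMap.mul' k H ∘ₗ
    LinearMap.lTensor H (antipode k ∘ₗ (Subalgebra.toSubmodule K).subtype ∘ₗ p)
  have hL : ∀ x y, L (x ⊗ₜ y) = x * antipode k (p y : H) := fun x y => rfl
  have h1 : L ((comul a : H ⊗[k] H) * (m ⊗ₜ[k] 1)) ∈ Subalgebra.toSubmodule K :=
    T2_map L _ (fun x hx y _ => by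
      rw [hL]; exact Subalgebra.mul_mem _ hx (hK.2 _ (p y).2)) hz
  have h2 : ∀ w : H ⊗[k] H, L (w * (m ⊗ₜ[k] 1)) = m * L w := by
    intro w
    induction w with
    | zero => simp
    | add x y hx hy => simp only [add_mul, map_add, hx, hy, mul_add]
    | tmul x y => rw [Algebra.TensorProduct.tmul_mul_tmul, hL, hL, mul_one]; ring
  have h3 : L (comul a) = 1 := by
    have e : (L - LinearMap.mul' k H ∘ₗ LinearMap.lTensor H (antipode k)) (comul a) ∈
        (⊥ : Submodule k H) := by
      refine T2_map _ _ (fun x hx y hy => ?_) (hK.1 a ha)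
      have := LinearMap.congr_fun hp ⟨y, hy⟩
      simp only [LinearMap.comp_apply, Submodule.subtype_apply, LinearMap.id_apply] at this
      simp [hL, this]
    rw [Submodule.mem_bot, LinearMap.sub_apply, sub_eq_zero] at e
    rw [e, LinearMap.comp_apply, mul_antipode_lTensor_comul_apply, hε, map_one]
  rw [h2, h3, mul_one] at h1
  exact h1

lemma RC_span_aux {K : Subalgebra k H} (hK : Good K) {V N : Submodule k H} (hV : RC V)
    (hVN : V ≤ N) (hN : ∀ a ∈ Subalgebra.toSubmodule K, ∀ b ∈ N, a * b ∈ N) (v : H)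
    (hv : v ∈ Submodule.span K (V : Set H)) : (comul v : H ⊗[k] H) ∈ T2 N ⊤ := by
  induction hv using Submodule.span_induction with
  | mem x hx => exact T2_mono hVN le_rfl (hV x hx)
  | zero => rw [map_zero]; exact zero_mem _
  | add x y _ _ hx hy => rw [map_add]; exact add_mem hx hy
  | smul c x _ hx =>
    rw [Subalgebra.smul_def, smul_eq_mul, Bialgebra.comul_mul]
    exact T2_mul (q'' := ⊤) hN (fun _ _ _ _ => trivial) (hK.1 _ c.2) hx

lemma RC_span {K : Subalgebra k H} (hK : Good K) {V : Submodule k H} (hV : RC V) :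
    RC ((Submodule.span K (V : Set H)).restrictScalars k) := fun v hv =>
  RC_span_aux hK hV (N := (Submodule.span K (V : Set H)).restrictScalars k) (fun _ hy => Submodule.subset_span hy)
    (fun a ha _ hb => Submodule.smul_mem (Submodule.span K (V : Set H)) (⟨a, ha⟩ : K) hb) v hv

/-- `K⁺`. -/
noncomputable def aug (K : Subalgebra k H) : Ideal K :=
  RingHom.ker ((Bialgebra.counitAlgHom k H).comp K.val)

lemma mem_aug {K : Subalgebra k H} (c : K) : c ∈ aug K ↔ counit (R := k) (c : H) = 0 := Iff.rfl

lemma exists_coords {E : Type*} [AddCommGroup E] [Module k E] (M U : Submodule k E)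
    (hfin : ∃ V : Submodule k E, V.FG ∧ M ≤ U ⊔ V) :
    ∃ (d : ℕ) (m : Fin d → E) (lam : Fin d → E →ₗ[k] k), (∀ i, m i ∈ M) ∧
      (∀ i, ∀ u ∈ U, lam i u = 0) ∧ (∀ i j, lam i (m j) = if i = j then 1 else 0) ∧
      ∀ x ∈ M, x - ∑ i, lam i x • m i ∈ U := by
  classical
  obtain ⟨V, hV, hMV⟩ := hfin
  let W := M.map U.mkQ
  have hW : W ≤ V.map U.mkQ := by
    refine (Submodule.map_mono hMV).trans ?_
    rw [Submodule.map_sup]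
    simp
  have : Module.Finite k (V.map U.mkQ) := Module.Finite.iff_fg.2 (hV.map _)
  have : Module.Finite k W := Submodule.finiteDimensional_of_le hW
  let b := Module.finBasis k W
  have hm : ∀ i, ∃ m ∈ M, U.mkQ m = b i := fun i => (b i).2
  choose m hm1 hm2 using hm
  have hg : ∀ i, ∃ g : (E ⧸ U) →ₗ[k] k, g ∘ₗ W.subtype = b.coord i :=
    fun i => LinearMap.exists_extend (b.coord i)
  choose g hg using hg
  have hg' : ∀ i (w : W), g i w = b.coord i w := fun i w => LinearMap.congr_fun (hg i) w
  refine ⟨_, m, fun i => g i ∘ₗ U.mkQ, hm1, ?_, ?_, ?_⟩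
  · intro i u hu
    rw [LinearMap.comp_apply, Submodule.mkQ_apply, (Submodule.Quotient.mk_eq_zero U).2 hu, map_zero]
  · intro i j
    rw [LinearMap.comp_apply, hm2, hg']
    simp [Finsupp.single_apply, eq_comm]
  · intro x hx
    rw [← Submodule.Quotient.mk_eq_zero, ← Submodule.mkQ_apply, map_sub, map_sum, sub_eq_zero]
    have hxW : U.mkQ x ∈ W := ⟨x, hx, rfl⟩
    have h1 := congrArg (Subtype.val) (b.sum_repr ⟨U.mkQ x, hxW⟩)
    simp only [Submodule.coe_sum, Submodule.coe_smul] at h1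
    conv_lhs => rw [← h1]
    refine Finset.sum_congr rfl fun i _ => ?_
    rw [map_smul, hm2, LinearMap.comp_apply, hg' i ⟨U.mkQ x, hxW⟩, Module.Basis.coord_apply]

lemma lam_mul (lam : H →ₗ[k] k) (A B : Submodule k H)
    (hlam : ∀ a ∈ A, ∀ x ∈ B, lam (a * x) = counit (R := k) a * lam x) {y z : H ⊗[k] H}
    (hy : y ∈ T2 A ⊤) (hz : z ∈ T2 B ⊤) :
    TensorProduct.lid k H (LinearMap.rTensor H lam (y * z)) =
      TensorProduct.lid k H (LinearMap.rTensor H counit y) *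
      TensorProduct.lid k H (LinearMap.rTensor H lam z) := by
  let Q : (H ⊗[k] H →ₗ[k] k ⊗[k] H) → H ⊗[k] H →ₗ[k] H :=
    fun f => (TensorProduct.lid k H).toLinearMap ∘ₗ f
  let P1 := Q (LinearMap.rTensor H lam)
  let P0 := Q (LinearMap.rTensor H counit)
  have e0 : ∀ a b, P0 (a ⊗ₜ b) = counit (R := k) a • b := fun a b => rfl
  have e1 : ∀ a b, P1 (a ⊗ₜ b) = lam a • b := fun a b => rfl
  change P1 (y * z) = P0 y * P1 z
  rw [← sub_eq_zero, ← Submodule.mem_bot k]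
  refine T2_map (P1 ∘ₗ LinearMap.mulRight k z - LinearMap.mulRight k (P1 z) ∘ₗ P0) ⊥
    (fun a ha b _ => ?_) hy
  simp only [LinearMap.sub_apply, LinearMap.comp_apply, LinearMap.mulRight_apply]
  refine T2_map (P1 ∘ₗ LinearMap.mulLeft k (a ⊗ₜ b) - LinearMap.mulLeft k (P0 (a ⊗ₜ b)) ∘ₗ P1) ⊥
    (fun x hx c _ => ?_) hz
  simp only [LinearMap.sub_apply, LinearMap.comp_apply, LinearMap.mulLeft_apply,
    Algebra.TensorProduct.tmul_mul_tmul, e0, e1, hlam a ha x hx, Submodule.mem_bot]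
  rw [smul_mul_smul_comm, sub_self]

lemma lam_one_tmul (lam : H →ₗ[k] k) (w : H ⊗[k] H) (s : H) :
    TensorProduct.lid k H (LinearMap.rTensor H lam (w * ((1 : H) ⊗ₜ[k] s))) =
      TensorProduct.lid k H (LinearMap.rTensor H lam w) * s := by
  induction w with
  | zero => simp
  | add x y hx hy => simp only [add_mul, map_add, hx, hy]
  | tmul x y => simp

lemma exists_fin_one {K : Subalgebra k H} (x : H) (hx : x ∈ (aug K • ⊤ : Submodule K H)) :
    ∃ s : Finset H, x ∈ aug K • Submodule.span K (s : Set H) := by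
  classical
  refine Submodule.smul_induction_on hx ?_ ?_
  · intro r hr n _
    exact ⟨{n}, Submodule.smul_mem_smul hr (Submodule.subset_span (by simp))⟩
  · intro x y hx hy
    obtain ⟨s, hs⟩ := hx
    obtain ⟨t, ht⟩ := hy
    refine ⟨s ∪ t, add_mem ?_ ?_⟩
    · exact Submodule.smul_mono le_rfl (Submodule.span_mono (by simp)) hs
    · exact Submodule.smul_mono le_rfl (Submodule.span_mono (by simp)) ht

lemma exists_fin {K : Subalgebra k H}
    (hgen : ∀ x : H, counit (R := k) x = 0 → x ∈ (aug K • ⊤ : Submodule K H)) (s : Finset H) :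
    ∃ s' : Finset H, ∀ x ∈ s, x ∈ Submodule.span K {(1 : H)} ⊔
      aug K • Submodule.span K (s' : Set H) := by
  classical
  induction s using Finset.induction_on with
  | empty => exact ⟨∅, by simp⟩
  | insert a s _ ih =>
    obtain ⟨t, ht⟩ := ih
    have h0 : counit (R := k) (a - algebraMap k H (counit a)) = 0 := by
      rw [map_sub, Bialgebra.counit_algebraMap, sub_self]
    obtain ⟨t', ht'⟩ := exists_fin_one _ (hgen _ h0)
    refine ⟨t ∪ t', fun x hx => ?_⟩
    rcases Finset.mem_insert.1 hx with rfl | hx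
    · have e : x = (algebraMap k K (counit x)) • (1 : H) + (x - algebraMap k H (counit x)) := by
        rw [Subalgebra.smul_def]; simp
      rw [e]
      exact add_mem (Submodule.mem_sup_left (Submodule.smul_mem _ _
        (Submodule.mem_span_singleton_self _)))
        (Submodule.mem_sup_right (Submodule.smul_mono le_rfl (Submodule.span_mono (by simp)) ht'))
    · have hle : Submodule.span K (t : Set H) ≤ Submodule.span K ((t ∪ t' : Finset H) : Set H) :=
        Submodule.span_mono (by simp)
      have hle2 : Submodule.span K {(1 : H)} ⊔ aug K • Submodule.span K (t : Set H) ≤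
          Submodule.span K {(1 : H)} ⊔ aug K • Submodule.span K ((t ∪ t' : Finset H) : Set H) :=
        sup_le_sup le_rfl (Submodule.smul_mono le_rfl hle)
      exact hle2 (ht x hx)

open scoped Pointwise in
lemma main_step {K : Subalgebra k H} (hK : Good K)
    (hgen : ∀ x : H, counit (R := k) x = 0 → x ∈ (aug K • ⊤ : Submodule K H)) (h : H) : h ∈ K := by
  classical
  obtain ⟨V, hVfg, hVs, hVRC⟩ := exists_RC_finset (k := k) {h}
  obtain ⟨s, hs⟩ := hVfg
  obtain ⟨s', hs'⟩ := exists_fin hgen s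
  obtain ⟨V', hVfg', hVs', hVRC'⟩ := exists_RC_finset (k := k) (insert 1 s')
  have hMRC := RC_span hK hVRC
  have hMRC' := RC_span hK hVRC'
  have hVM : (V : Set H) ⊆ Submodule.span K (V : Set H) := Submodule.subset_span
  have hVM' : (V' : Set H) ⊆ Submodule.span K (V' : Set H) := Submodule.subset_span
  have hMfg' : (Submodule.span K (V' : Set H)).FG := by
    obtain ⟨u, hu⟩ := hVfg'
    refine ⟨u, ?_⟩
    rw [← hu, Submodule.span_span_of_tower]
  have hMs : Submodule.span K (V : Set H) = Submodule.span K (s : Set H) := by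
    rw [← hs, Submodule.span_span_of_tower]
  have hs'M' : Submodule.span K (s' : Set H) ≤ Submodule.span K (V' : Set H) :=
    Submodule.span_mono fun x hx => hVs' x (Finset.mem_insert_of_mem hx)
  have h1M' : (1 : H) ∈ Submodule.span K (V' : Set H) := hVM' (hVs' 1 (Finset.mem_insert_self _ _))
  have hM'V' : ∀ U : Submodule K H, aug K • Submodule.span K (V' : Set H) ≤ U →
      (Submodule.span K (V' : Set H)).restrictScalars k ≤ U.restrictScalars k ⊔ V' := by
    intro U hU x hx
    rw [Submodule.restrictScalars_mem] at hx
    induction hx using Submodule.span_induction with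
    | mem x hx => exact Submodule.mem_sup_right hx
    | zero => exact zero_mem _
    | add x y _ _ hx hy => exact add_mem hx hy
    | smul c x hxm hx =>
      have e : c • x = (c - algebraMap k K (counit (c : H))) • x + counit (R := k) (c : H) • x := by
        rw [sub_smul, algebraMap_smul, sub_add_cancel]
      rw [e]
      refine add_mem (Submodule.mem_sup_left ?_) (Submodule.smul_mem _ _ hx)
      refine hU (Submodule.smul_mem_smul ?_ hxm)
      rw [mem_aug]
      simp
  have hhM : h ∈ Submodule.span K (V : Set H) := hVM (hVs h (by simp))
  have hMU : Submodule.span K (V : Set H) ≤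
      Submodule.span K {(1 : H)} ⊔ aug K • Submodule.span K (V' : Set H) := by
    rw [hMs, Submodule.span_le]
    intro x hx
    exact sup_le_sup le_rfl (Submodule.smul_mono le_rfl hs'M') (hs' x hx)
  generalize Submodule.span K (V : Set H) = M at *
  generalize Submodule.span K (V' : Set H) = M' at *
  set U : Submodule K H := Submodule.span K {(1 : H)} ⊔ aug K • M' with hU
  have hUM' : U ≤ M' := sup_le (by rw [Submodule.span_le]; simpa using h1M')
    Submodule.smul_le_right
  have h1U : (1 : H) ∈ U := Submodule.mem_sup_left (Submodule.mem_span_singleton_self _)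
  obtain ⟨d, m, lam, hm, hlU, hlm, hdiff⟩ := exists_coords (M'.restrictScalars k)
    (U.restrictScalars k) ⟨V', hVfg', hM'V' U le_sup_right⟩
  let Ps : Fin d → H →ₗ[k] H := fun i =>
    (TensorProduct.lid k H).toLinearMap ∘ₗ LinearMap.rTensor H (lam i) ∘ₗ comul
  have hPs : ∀ i x, Ps i x = TensorProduct.lid k H (LinearMap.rTensor H (lam i) (comul x)) :=
    fun i x => rfl
  have P1 : ∀ i (c : K), ∀ x ∈ M', Ps i ((c : H) * x) = c * Ps i x := by
    intro i c x hx
    have hl : ∀ a ∈ Subalgebra.toSubmodule K, ∀ x ∈ M'.restrictScalars k,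
        lam i (a * x) = counit (R := k) a * lam i x := by
      intro a ha x hx
      have : lam i ((⟨a, ha⟩ - algebraMap k K (counit a) : K) • x) = 0 := by
        refine hlU i _ (Submodule.mem_sup_right (Submodule.smul_mem_smul ?_ hx))
        rw [mem_aug]; simp
      rw [sub_smul, algebraMap_smul, map_sub, map_smul (lam i) (counit (R := k) a) x,
        sub_eq_zero] at this
      exact this
    have := lam_mul (lam i) _ _ hl (T2_mono le_rfl le_top (hK.1 c c.2)) (hMRC' x hx)
    rw [hPs, Bialgebra.comul_mul, this, rTensor_counit_comul, hPs]
    simp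
  have P2 : ∀ i, ∀ x ∈ M, Ps i x = 0 := by
    intro i x hx
    rw [← Submodule.mem_bot k]
    refine T2_map ((TensorProduct.lid k H).toLinearMap ∘ₗ LinearMap.rTensor H (lam i)) ⊥
      (fun a ha b _ => ?_) (hMRC x hx)
    simp [hlU i a (hMU ha)]
  have Pone : ∀ i, Ps i 1 = 0 := by
    intro i
    rw [hPs, Bialgebra.comul_one, Algebra.TensorProduct.one_def]
    simp [hlU i 1 h1U]
  have hNak : M' ≤ (Submodule.span K {(1 : H)} ⊔ Submodule.span K (Set.range m)) ⊔ aug K • M' := by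
    intro x hx
    have e := hdiff x hx
    have e2 : ∑ i, lam i x • m i ∈ Submodule.span K (Set.range m) :=
      Submodule.sum_mem _ fun i _ => Submodule.smul_of_tower_mem _ _
        (Submodule.subset_span ⟨i, rfl⟩)
    rw [← sub_add_cancel x (∑ i, lam i x • m i)]
    refine add_mem ?_ (Submodule.mem_sup_left (Submodule.mem_sup_right e2))
    exact (sup_le_sup le_sup_left le_rfl :
      U ≤ (Submodule.span K {(1 : H)} ⊔ Submodule.span K (Set.range m)) ⊔ aug K • M') e
  obtain ⟨r, hr1, hr⟩ := Submodule.exists_sub_one_mem_and_smul_le_of_fg_of_le_sup hMfg' le_rfl hNak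
  have hεr : counit (R := k) (r : H) = 1 := by
    rw [mem_aug] at hr1
    simpa [sub_eq_zero] using hr1
  have hdec : ∀ x ∈ M', ∃ (c0 : K) (c : Fin d → K), (r : H) * x = c0 + ∑ j, (c j : H) * m j := by
    intro x hx
    have := hr (Submodule.smul_mem_pointwise_smul x r M' hx)
    obtain ⟨y, hy, z, hz, hyz⟩ := Submodule.mem_sup.1 this
    obtain ⟨c0, rfl⟩ := Submodule.mem_span_singleton.1 hy
    obtain ⟨c, rfl⟩ := (Submodule.mem_span_range_iff_exists_fun K).1 hz
    refine ⟨c0, c, ?_⟩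
    simp only [Subalgebra.smul_def, smul_eq_mul, mul_one] at hyz
    exact hyz.symm
  let T : Matrix (Fin d) (Fin d) H := Matrix.of fun j i => Ps i (m j)
  have hT : ∀ x ∈ M', ∀ (c0 : K) (c : Fin d → K), (r : H) * x = c0 + ∑ j, (c j : H) * m j →
      ∀ i, (r : H) * Ps i x = ∑ j, (c j : H) * T j i := by
    intro x hx c0 c hc i
    rw [← P1 i r x hx, hc, map_add, map_sum]
    have : Ps i (c0 : H) = 0 := by
      have := P1 i c0 1 h1M'
      rwa [Pone, mul_one, mul_zero] at this
    rw [this, zero_add]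
    exact Finset.sum_congr rfl fun j _ => P1 i (c j) (m j) (hm j)
  have hB : ∀ l, ∃ B : Fin d → H, ∀ i, Matrix.vecMul B T i = (r : H) * (if i = l then 1 else 0) := by
    intro l
    let f : H ⊗[k] H →ₗ[k] (Fin d → H) := LinearMap.pi fun i =>
      LinearMap.mulLeft k (r : H) ∘ₗ (TensorProduct.lid k H).toLinearMap ∘ₗ
        LinearMap.rTensor H (lam i) ∘ₗ Th
    have hf : ∀ z i, f z i = r * TensorProduct.lid k H (LinearMap.rTensor H (lam i) (Th z)) :=
      fun z i => rfl
    have hmem : f (comul (m l)) ∈ (LinearMap.range (Matrix.vecMulLinear T)).restrictScalars k := by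
      refine T2_map f _ (fun x hx y _ => ?_) (hMRC' _ (hm l))
      obtain ⟨c0, c, hc⟩ := hdec x hx
      refine ⟨fun j => c j * antipode k y, ?_⟩
      funext i
      rw [hf, Th_tmul, lam_one_tmul, ← hPs, ← mul_assoc, hT x hx c0 c hc i, Finset.sum_mul]
      simp only [Matrix.vecMulLinear_apply, Matrix.vecMul, dotProduct]
      exact Finset.sum_congr rfl fun j _ => by ring
    obtain ⟨B, hB⟩ := hmem
    refine ⟨B, fun i => ?_⟩
    have := congrFun hB i
    rw [Matrix.vecMulLinear_apply, hf, Th_comul] at this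
    rw [this]
    simp [hlm]
  choose B hB using hB
  have hBT : Matrix.of B * T = (r : H) • (1 : Matrix (Fin d) (Fin d) H) := by
    ext l i
    have := hB l i
    simp only [Matrix.vecMul, dotProduct] at this
    simp [Matrix.mul_apply, this, Matrix.one_apply, eq_comm]
  have hdet : (Matrix.of B).det * T.det = (r : H) ^ d := by
    rw [← Matrix.det_mul, hBT]; simp
  have hfin : ∀ n ∈ M.restrictScalars k, ((r ^ (d + 1) : K) : H) * n ∈ K := by
    intro n hn
    have hn' : n ∈ M' := hUM' (hMU hn)
    obtain ⟨c0, c, hc⟩ := hdec n hn'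
    have h0 : Matrix.vecMul (fun j => (c j : H)) T = 0 := by
      funext i
      have := hT n hn' c0 c hc i
      rw [P2 i n hn, mul_zero] at this
      simp only [Matrix.vecMul, dotProduct, Pi.zero_apply]
      exact this.symm
    have h1 : T.det • (fun j => (c j : H)) = 0 := by
      have := congrArg (fun v => Matrix.vecMul v T.adjugate) h0
      simpa [Matrix.vecMul_vecMul, Matrix.mul_adjugate, Matrix.vecMul_smul] using this
    have h2 : ∀ j, (r : H) ^ d * c j = 0 := by
      intro j
      have := congrFun h1 j
      simp only [Pi.smul_apply, smul_eq_mul, Pi.zero_apply] at this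
      rw [← hdet, mul_assoc, this, mul_zero]
    have e : ((r ^ (d + 1) : K) : H) * n = ((r ^ d * c0 : K) : H) := by
      push_cast
      rw [pow_succ, mul_assoc, hc, mul_add, Finset.mul_sum, Finset.sum_eq_zero, add_zero]
      intro j _
      rw [← mul_assoc, h2, zero_mul]
    rw [e]
    exact (r ^ d * c0).2
  refine final hK hMRC _ (r ^ (d + 1)).2 ?_ hfin h hhM
  have := map_pow (Bialgebra.counitAlgHom k H) (r : H) (d + 1)
  simp only [Bialgebra.counitAlgHom_apply, hεr, one_pow] at this
  simpa using this

end MolnarAux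

open MolnarAux in
/-- Molnar: a commutative Hopf algebra over a field is noetherian iff it is
an affine (finitely generated) `k`-algebra. -/
theorem commutative_hopfAlgebra_isNoetherianRing_iff_finiteType
    (k H : Type*) [Field k] [CommRing H] [HopfAlgebra k H] :
    IsNoetherianRing H ↔ Algebra.FiniteType k H := by
  constructor
  · intro _
    obtain ⟨s, hs⟩ := (isNoetherianRing_iff_ideal_fg H).1 ‹_›
      (RingHom.ker (Bialgebra.counitAlgHom k H))
    obtain ⟨K, hfg, hK, hsK⟩ := exists_good_finset (k := k) s
    have hgen : ∀ x : H, Coalgebra.counit (R := k) x = 0 → x ∈ (aug K • ⊤ : Submodule K H) := by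
      intro x hx
      have hx' : x ∈ RingHom.ker (Bialgebra.counitAlgHom k H) := hx
      rw [← hs] at hx'
      obtain ⟨f, -, rfl⟩ := Submodule.mem_span_finset.1 hx'
      refine Submodule.sum_mem _ fun i hi => ?_
      have hi0 : i ∈ RingHom.ker (Bialgebra.counitAlgHom k H) := hs ▸ Submodule.subset_span hi
      have : f i • i = (⟨i, hsK i hi⟩ : K) • f i := by
        rw [Subalgebra.smul_def, smul_eq_mul, smul_eq_mul, mul_comm]
      rw [this]
      exact Submodule.smul_mem_smul hi0 trivial
    have : K = ⊤ := by
      ext x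
      exact ⟨fun _ => trivial, fun _ => main_step hK hgen x⟩
    exact ⟨this ▸ hfg⟩
  · intro _
    exact Algebra.FiniteType.isNoetherianRing k H
end

section
/- Let k be a field and let H be a cocommutative Hopf algebra over k. If H is a noetherian ring, then H is an affine k-algebra, i.e. finitely generated as a k-algebra. -/
namespace Molnar
open TensorProduct Coalgebra HopfAlgebra

section
variable {F A : Type*} [Field F] [Ring A] [HopfAlgebra F A]

/-- hit operator -/
noncomputable def T (f : A →ₗ[F] F) : A →ₗ[F] A :=
  (TensorProduct.lid F A).toLinearMap ∘ₗ f.rTensor A ∘ₗ comul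

lemma T_repr (f : A →ₗ[F] F) {a : A} {ι : Type*} (r : Repr F a ι) :
    T f a = ∑ i ∈ r.index, f (r.left i) • r.right i := by
  simp [T, ← r.eq, map_sum]

lemma T_counit (a : A) : T (counit : A →ₗ[F] F) a = a := by
  simp [T]

lemma counit_T (f : A →ₗ[F] F) (a : A) : counit (R := F) (T f a) = f a := by
  have h := congrArg f (sum_counit_smul (ℛ F a))
  have h2 := congrArg (fun z => f (TensorProduct.rid F A z)) (lTensor_counit_comul (R := F) a)
  rw [T_repr f (ℛ F a)]
  simp only [← (ℛ F a).eq, map_sum, LinearMap.lTensor_tmul, TensorProduct.rid_tmul, map_smul, one_smul, smul_eq_mul] at h2 ⊢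
  rw [← h2]
  exact Finset.sum_congr rfl fun _ _ => mul_comm _ _

noncomputable def cv (h f : A →ₗ[F] F) : A →ₗ[F] F :=
  LinearMap.mul' F F ∘ₗ TensorProduct.map h f ∘ₗ comul

lemma cv_eq (h f : A →ₗ[F] F) (a : A) : cv h f a = f (T h a) := by
  rw [T_repr h (ℛ F a)]
  simp [cv, ← (ℛ F a).eq, map_sum]

lemma cv_comm [IsCocomm F A] (h f : A →ₗ[F] F) : cv h f = cv f h := by
  ext a
  have := comm_comul F a
  simp only [cv, LinearMap.comp_apply]
  conv_lhs => rw [← this]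
  rw [← (ℛ F a).eq]
  simp [map_sum, mul_comm]

lemma T_T (f h : A →ₗ[F] F) (a : A) : T f (T h a) = T (cv h f) a := by
  let Φ : A ⊗[F] (A ⊗[F] A) →ₗ[F] A :=
    (TensorProduct.lid F A).toLinearMap ∘ₗ TensorProduct.map h
      ((TensorProduct.lid F A).toLinearMap ∘ₗ f.rTensor A)
  have e1 : T f (T h a) = Φ (comul.lTensor A (comul a)) := by
    rw [← (ℛ F a).eq, T_repr h (ℛ F a)]
    simp [Φ, map_sum, T]
  have e2 : T (cv h f) a = Φ (TensorProduct.assoc F A A A (comul.rTensor A (comul a))) := by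
    have : ∀ z : A ⊗[F] A, (TensorProduct.lid F A) ((cv h f).rTensor A z) =
        Φ (TensorProduct.assoc F A A A (comul.rTensor A z)) := by
      intro z
      induction z with
      | zero => simp
      | add x y hx hy => simp only [map_add, hx, hy]
      | tmul x y =>
        simp only [LinearMap.rTensor_tmul, cv, LinearMap.comp_apply]
        rw [← (ℛ F x).eq]
        simp only [map_sum, TensorProduct.sum_tmul, Φ, mul_smul, TensorProduct.map_tmul, LinearMap.mul'_apply, TensorProduct.lid_tmul, TensorProduct.assoc_tmul, LinearMap.comp_apply, LinearEquiv.coe_coe, LinearMap.rTensor_tmul]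
    exact this _
  rw [e1, e2, coassoc_apply]

lemma T_T_comm [IsCocomm F A] (f h : A →ₗ[F] F) (a : A) : T f (T h a) = T h (T f a) := by
  rw [T_T, T_T, cv_comm]

lemma T_mul (f : A →ₗ[F] F) (a x : A) {ι : Type*} (r : Repr F x ι) :
    T f (a * x) = ∑ i ∈ r.index, T (f ∘ₗ LinearMap.mulRight F (r.left i)) a * r.right i := by
  have h : ∀ i, T (f ∘ₗ LinearMap.mulRight F (r.left i)) a * r.right i =
     ∑ j ∈ (ℛ F a).index, f ((ℛ F a).left j * r.left i) • ((ℛ F a).right j * r.right i) := by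
    intro i
    rw [T_repr _ (ℛ F a)]
    simp [Finset.sum_mul]
  simp only [h]
  rw [Finset.sum_comm]
  have := Bialgebra.comul_mul (R := F) a x
  simp only [T, LinearMap.comp_apply, this]
  rw [← (ℛ F a).eq, ← r.eq]
  simp [Finset.sum_mul, Finset.mul_sum, map_sum]
  try rw [Finset.sum_comm]

lemma exists_T_of_li {ι : Type*} {u : ι → A} (hu : LinearIndependent F u) {x : A} (c : ι →₀ A)
    (hc : comul (R := F) x = c.sum fun i n => u i ⊗ₜ[F] n) (i : ι) :
    ∃ f : A →ₗ[F] F, c i = T f x := by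
  classical
  obtain ⟨f, hf⟩ := LinearMap.exists_extend ((Finsupp.lapply i) ∘ₗ hu.repr)
  have hfu : ∀ j, f (u j) = if j = i then 1 else 0 := by
    intro j
    have := LinearMap.congr_fun hf ⟨u j, Submodule.subset_span ⟨j, rfl⟩⟩
    simp only [LinearMap.comp_apply, Submodule.subtype_apply] at this
    rw [this, hu.repr_eq_single j _ rfl]
    simp [Finsupp.single_apply]
  refine ⟨f, ?_⟩
  simp only [T, LinearMap.comp_apply, hc, Finsupp.sum, map_sum, LinearMap.rTensor_tmul, hfu,
    LinearEquiv.coe_coe, TensorProduct.lid_tmul, ite_smul, one_smul, zero_smul]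
  simp

lemma exists_T_repr (K : Submodule F A) {a : A}
    (ha : comul (R := F) a ∈ LinearMap.range (TensorProduct.map K.subtype K.subtype)) :
    ∃ r : Repr F a (Module.Basis.ofVectorSpaceIndex F K), (∀ i, r.left i ∈ K) ∧
      (∀ i, r.right i ∈ K) ∧
      (∀ i, ∃ f : A →ₗ[F] F, r.right i = T f a) := by
  obtain ⟨z, hz⟩ := ha
  obtain ⟨c, rfl⟩ := TensorProduct.eq_repr_basis_left (Module.Basis.ofVectorSpace F K) z
  set b := Module.Basis.ofVectorSpace F K
  have hli : LinearIndependent F (fun i => (b i : A)) :=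
    b.linearIndependent.map' K.subtype (Submodule.ker_subtype K)
  have he : comul (R := F) a = c.sum fun i n => (b i : A) ⊗ₜ[F] (n : A) := by
    rw [← hz]; simp [Finsupp.sum, map_sum]
  refine ⟨⟨c.support, fun i => b i, fun i => c i, he.symm⟩, fun i => (b i).2, fun i => (c i).2,
    fun i => ?_⟩
  obtain ⟨f, hf⟩ := exists_T_of_li hli (c.mapRange (fun n : K => (n : A)) rfl)
    (by rw [he, Finsupp.sum_mapRange_index (by simp)]) i
  exact ⟨f, by simpa using hf⟩

lemma comul_mem_range [IsCocomm F A] (V : Submodule F A)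
    (hV : ∀ f : A →ₗ[F] F, ∀ x ∈ V, T f x ∈ V) {x : A} (hx : x ∈ V) :
    comul (R := F) x ∈ LinearMap.range (TensorProduct.map V.subtype V.subtype) := by
  obtain ⟨c, hc⟩ := TensorProduct.eq_repr_basis_left (Module.Basis.ofVectorSpace F A)
    (comul (R := F) x)
  have h1 : ∃ z : A ⊗[F] V, TensorProduct.map LinearMap.id V.subtype z = comul (R := F) x := by
    have hcV : ∀ i, c i ∈ V := fun i => by
      obtain ⟨f, hf⟩ := exists_T_of_li (Module.Basis.ofVectorSpace F A).linearIndependent c hc.symm i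
      rw [hf]; exact hV f x hx
    refine ⟨∑ i ∈ c.support, (Module.Basis.ofVectorSpace F A) i ⊗ₜ ⟨c i, hcV i⟩, ?_⟩
    rw [← hc]
    simp [Finsupp.sum, map_sum]
  obtain ⟨z, hz⟩ := h1
  obtain ⟨d, rfl⟩ := TensorProduct.eq_repr_basis_right (Module.Basis.ofVectorSpace F V) z
  set b := Module.Basis.ofVectorSpace F V
  have hli : LinearIndependent F (fun i => (b i : A)) :=
    b.linearIndependent.map' V.subtype (Submodule.ker_subtype V)
  have he : comul (R := F) x = d.sum fun i n => (b i : A) ⊗ₜ[F] n := by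
    rw [← comm_comul F x, ← hz]; simp [Finsupp.sum, map_sum]
  have hdV : ∀ i, d i ∈ V := fun i => by
    obtain ⟨f, hf⟩ := exists_T_of_li hli d he i
    rw [hf]; exact hV f x hx
  refine ⟨∑ i ∈ d.support, b i ⊗ₜ ⟨d i, hdV i⟩, ?_⟩
  rw [he]
  simp [Finsupp.sum, map_sum]

lemma fin_T (a : A) : ∃ V : Submodule F A, FiniteDimensional F V ∧ a ∈ V ∧
    (∀ f : A →ₗ[F] F, ∀ x ∈ V, T f x ∈ V) ∧ ∀ x ∈ V, ∃ f : A →ₗ[F] F, x = T f a := by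
  let L : (A →ₗ[F] F) →ₗ[F] A :=
    { toFun := fun f => T f a
      map_add' := fun f g => by simp [T, LinearMap.rTensor_add]
      map_smul' := fun c f => by simp [T, LinearMap.rTensor_smul] }
  refine ⟨LinearMap.range L, ?_, ⟨counit, T_counit a⟩, ?_, ?_⟩
  · classical
    have : LinearMap.range L ≤ Submodule.span F ((ℛ F a).index.image (ℛ F a).right : Finset A) := by
      rintro _ ⟨f, rfl⟩
      change T f a ∈ _
      rw [T_repr f (ℛ F a)]
      refine Submodule.sum_mem _ fun i hi => Submodule.smul_mem _ _ (Submodule.subset_span ?_)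
      simp only [Finset.coe_image]
      exact ⟨i, hi, rfl⟩
    exact Submodule.finiteDimensional_of_le this
  · rintro f _ ⟨h, rfl⟩
    exact ⟨cv h f, (T_T f h a).symm⟩
  · rintro _ ⟨f, rfl⟩
    exact ⟨f, rfl⟩

/-- common eigenvector -/
lemma common_eig {Q ι : Type*} [AddCommGroup Q] [Module F Q] [IsAlgClosed F]
    (S : ι → Module.End F Q) (hc : ∀ i j q, S i (S j q) = S j (S i q)) (n : ℕ) :
    ∀ (W : Submodule F Q) [FiniteDimensional F W], W ≠ ⊥ → (∀ i, ∀ w ∈ W, S i w ∈ W) →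
    Module.finrank F W = n → ∃ q, q ≠ 0 ∧ q ∈ W ∧ ∀ i, ∃ c : F, S i q = c • q := by
  induction n using Nat.strong_induction_on with
  | _ n ih =>
    intro W _ hW hst hn
    by_cases hall : ∀ i, ∃ c : F, ∀ w ∈ W, S i w = c • w
    · obtain ⟨q, hq, hq0⟩ := Submodule.exists_mem_ne_zero_of_ne_bot hW
      exact ⟨q, hq0, hq, fun i => (hall i).imp fun c h => h q hq⟩
    · push Not at hall
      obtain ⟨i, hi⟩ := hall
      have : Nontrivial W := Submodule.nontrivial_iff_ne_bot.2 hW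
      obtain ⟨c, hc'⟩ := Module.End.exists_eigenvalue ((S i).restrict (hst i))
      obtain ⟨v, hv⟩ := hc'.exists_hasEigenvector
      obtain ⟨w, hw, hwne⟩ := hi c
      let W' : Submodule F Q := W ⊓ LinearMap.ker (S i - c • LinearMap.id)
      have hlt : W' < W := by
        refine lt_of_le_of_ne inf_le_left fun h => hwne ?_
        have : w ∈ W' := h ▸ hw
        simpa [sub_eq_zero] using this.2
      have hvW : (v : Q) ∈ W' := by
        refine ⟨v.2, ?_⟩
        have := congrArg Subtype.val hv.apply_eq_smul
        simpa [sub_eq_zero] using this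
      have : FiniteDimensional F W' := Submodule.finiteDimensional_of_le hlt.le
      obtain ⟨q, h0, hq, h⟩ := ih _ (hn ▸ Submodule.finrank_lt_finrank_of_lt hlt) W'
        (fun h => hv.2 (by simpa [h] using hvW))
        (fun j w hw => ⟨hst j w hw.1, by
          have := hw.2
          have this : S i w = c • w := by simpa [sub_eq_zero] using this
          suffices S i (S j w) = c • S j w by simpa [sub_eq_zero] using this
          rw [hc, this, map_smul]⟩) rfl
      exact ⟨q, h0, hlt.le hq, h⟩

lemma exists_eig [IsAlgClosed F] [IsCocomm F A] (N : Submodule F A)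
    (hN : ∀ f : A →ₗ[F] F, ∀ x ∈ N, T f x ∈ N) (hne : N ≠ ⊤) :
    ∃ m, m ∉ N ∧ ∃ g g' : A, g' * g = 1 ∧ ∀ f : A →ₗ[F] F, T f m - f g • m ∈ N := by
  obtain ⟨a, -, ha⟩ := SetLike.exists_of_lt hne.lt_top
  obtain ⟨V, hVf, haV, hVst, -⟩ := fin_T (F := F) a
  let S : (A →ₗ[F] F) → Module.End F (A ⧸ N) := fun f => N.mapQ N (T f) (hN f)
  obtain ⟨q, hq0, hqW, hq⟩ := common_eig S
    (fun f h q => by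
      obtain ⟨b, rfl⟩ := N.mkQ_surjective q
      simp [S, T_T_comm f h b]) _ (V.map N.mkQ)
    (fun h => ha (by
      have : N.mkQ a ∈ V.map N.mkQ := ⟨a, haV, rfl⟩
      rw [h] at this
      simpa using this))
    (by
      rintro f _ ⟨v, hv, rfl⟩
      exact ⟨T f v, hVst f v hv, by simp [S]⟩) rfl
  obtain ⟨m, rfl⟩ := N.mkQ_surjective q
  choose l hl using hq
  have hl' : ∀ f : A →ₗ[F] F, T f m - l f • m ∈ N := by
    intro f
    rw [← Submodule.Quotient.mk_eq_zero]
    have := hl f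
    simpa [S, sub_eq_zero] using this
  obtain ⟨θ, hθ⟩ : ∃ θ : Module.Dual F (A ⧸ N), θ (N.mkQ m) = 1 := by
    have : ∃ θ : Module.Dual F (A ⧸ N), θ (N.mkQ m) ≠ 0 := by
      by_contra! h
      exact hq0 ((Module.forall_dual_apply_eq_zero_iff F _).1 h)
    obtain ⟨θ, h⟩ := this
    exact ⟨(θ (N.mkQ m))⁻¹ • θ, by simp [-Submodule.mkQ_apply, inv_mul_cancel₀ h]⟩
  have hmN : m ∉ N := fun h => hq0 (by simpa using h)
  set g := T (θ ∘ₗ N.mkQ) m with hg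
  have hlg : ∀ f, l f = f g := by
    intro f
    rw [hg, ← cv_eq, cv_comm, cv_eq]
    have h1 : N.mkQ (T f m) = l f • N.mkQ m := hl f
    rw [LinearMap.comp_apply, h1, map_smul, hθ]; simp
  have huniq : ∀ c : F, c • m ∈ N → c = 0 := by
    intro c hc
    by_contra h0
    exact hmN (by simpa [h0] using N.smul_mem c⁻¹ hc)
  have hε : counit (R := F) g = 1 := by
    have := hl' counit
    rw [hlg, T_counit] at this
    have := huniq (1 - counit (R := F) g) (by simpa [sub_smul] using this)
    exact (sub_eq_zero.1 this).symm
  have hTg : ∀ f : A →ₗ[F] F, T f g = f g • g := by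
    intro f
    rw [← sub_eq_zero]
    refine (Module.forall_dual_apply_eq_zero_iff F _).1 fun e => ?_
    rw [map_sub, map_smul, ← cv_eq, smul_eq_mul]
    apply huniq
    have h1 := hl' (cv f e)
    rw [hlg, ← T_T] at h1
    have h2 := hN e _ (hl' f)
    rw [hlg, map_sub, map_smul] at h2
    have h3 := N.smul_mem (f g) (hl' e)
    rw [hlg] at h3
    have := N.sub_mem (N.add_mem h2 h3) h1
    convert this using 1
    simp only [smul_sub, sub_smul, mul_smul]
    abel
  obtain ⟨r, -, -, hr⟩ := exists_T_repr ⊤ (comul_mem_range (F := F) (⊤ : Submodule F A) (by simp) (x := g) trivial)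
  choose fr hfr using hr
  refine ⟨m, hmN, g, ∑ i ∈ r.index, fr i g • antipode F (r.left i), ?_, fun f => hlg f ▸ hl' f⟩
  have := sum_antipode_mul_eq_smul r
  rw [hε, one_smul] at this
  rw [← this, Finset.sum_mul]
  exact Finset.sum_congr rfl fun i _ => by rw [hfr, hTg]; simp

lemma free_step [IsCocomm F A] (K : Subalgebra F A)
    (hΔ : ∀ x ∈ K, comul (R := F) x ∈ LinearMap.range
      (TensorProduct.map (Subalgebra.toSubmodule K).subtype (Subalgebra.toSubmodule K).subtype))
    (hS : ∀ x ∈ K, antipode F x ∈ K) (N : Submodule F A)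
    (hN : ∀ f : A →ₗ[F] F, ∀ x ∈ N, T f x ∈ N)
    (hNK : ∀ n ∈ N, ∀ x ∈ K, n * x ∈ N) {m g g' : A} (hgg : g' * g = 1) (hm : m ∉ N)
    (hmg : ∀ f : A →ₗ[F] F, T f m - f g • m ∈ N) :
    (∀ x ∈ K, ∀ f : A →ₗ[F] F, T f x ∈ K) ∧
    (∀ x ∈ K, ∀ f : A →ₗ[F] F, T f (m * x) - m * T (f ∘ₗ LinearMap.mulLeft F g) x ∈ N) ∧
    (∀ x ∈ K, m * x ∈ N → x = 0) := by
  have h0 : ∀ x ∈ K, ∀ f : A →ₗ[F] F, T f x ∈ K := by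
    intro x hx f
    obtain ⟨r, hrl, hrr, hr⟩ := exists_T_repr _ (hΔ x hx)
    rw [T_repr f r]
    exact Subalgebra.sum_mem _ fun i _ => K.smul_mem (hrr i) _
  have h1 : ∀ x ∈ K, ∀ f : A →ₗ[F] F,
      T f (m * x) - m * T (f ∘ₗ LinearMap.mulLeft F g) x ∈ N := by
    intro x hx f
    obtain ⟨r, hrl, hrr, hr⟩ := exists_T_repr _ (hΔ x hx)
    rw [T_mul f m x r, T_repr _ r, Finset.mul_sum, ← Finset.sum_sub_distrib]
    refine N.sum_mem fun i _ => ?_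
    convert hNK _ (hmg (f ∘ₗ LinearMap.mulRight F (r.left i))) _ (hrr i) using 1
    simp [sub_mul]
  refine ⟨h0, h1, ?_⟩
  intro x hx hmx
  have h2 : ∀ y ∈ K, m * y ∈ N → ∀ f : A →ₗ[F] F, m * T f y ∈ N := by
    intro y hy hmy f
    have h := h1 y hy (f ∘ₗ LinearMap.mulLeft F g')
    have e : (f ∘ₗ LinearMap.mulLeft F g') ∘ₗ LinearMap.mulLeft F g = f := by
      ext z; simp [← mul_assoc, hgg]
    rw [e] at h
    simpa using N.sub_mem (hN (f ∘ₗ LinearMap.mulLeft F g') _ hmy) h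
  refine (Module.forall_dual_apply_eq_zero_iff F _).1 fun f => ?_
  by_contra hf
  have hy := h0 x hx f
  obtain ⟨r, hrl, hrr, hr⟩ := exists_T_repr _ (hΔ _ hy)
  have hsum : ∑ i ∈ r.index, r.right i * antipode F (r.left i) = f x • (1 : A) := by
    have hc := comm_comul F (T f x)
    rw [← r.eq, map_sum] at hc
    simp only [TensorProduct.comm_tmul] at hc
    rw [r.eq] at hc
    have := sum_mul_antipode_eq_smul (R := F) (⟨r.index, r.right, r.left, hc⟩ : Repr F (T f x) _)
    rwa [counit_T] at this
  have : f x • m ∈ N := by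
    have e : f x • m = ∑ i ∈ r.index, m * r.right i * antipode F (r.left i) := by
      simp only [mul_assoc]
      rw [← Finset.mul_sum, hsum]; simp
    rw [e]
    refine N.sum_mem fun i _ => hNK _ ?_ _ (hS _ (hrl i))
    obtain ⟨e, he⟩ := hr i
    rw [he]
    exact h2 _ hy (h2 _ hx hmx f) e
  exact hm (by simpa [hf] using N.smul_mem (f x)⁻¹ this)

/-- partial invariant functionals, as graphs -/
def PG (K : Subalgebra F A) (Γ : Submodule F (A × F)) : Prop :=
  (∀ p ∈ Γ, ∀ x ∈ K, (p.1 * x, p.2 * counit (R := F) x) ∈ Γ) ∧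
  (∀ c : F, ((0 : A), c) ∈ Γ → c = 0) ∧
  (∀ f : A →ₗ[F] F, ∀ p ∈ Γ, ∃ c : F, (T f p.1, c) ∈ Γ)

lemma extend_step [IsAlgClosed F] [IsCocomm F A] (K : Subalgebra F A)
    (hΔ : ∀ x ∈ K, comul (R := F) x ∈ LinearMap.range
      (TensorProduct.map (Subalgebra.toSubmodule K).subtype (Subalgebra.toSubmodule K).subtype))
    (hS : ∀ x ∈ K, antipode F x ∈ K) (Γ : Submodule F (A × F)) (hΓ : PG K Γ)
    (hne : Γ.map (LinearMap.fst F A F) ≠ ⊤) (c : F) :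
    ∃ Γ', Γ ≤ Γ' ∧ PG K Γ' ∧ ∃ m, m ∉ Γ.map (LinearMap.fst F A F) ∧ (m, c) ∈ Γ' := by
  obtain ⟨hg1, hg2, hg3⟩ := hΓ
  set N := Γ.map (LinearMap.fst F A F) with hNdef
  have hmem : ∀ n, n ∈ N ↔ ∃ d, (n, d) ∈ Γ := by
    intro n; simp [hNdef]
  have hN : ∀ f : A →ₗ[F] F, ∀ x ∈ N, T f x ∈ N := by
    intro f x hx
    obtain ⟨d, hd⟩ := (hmem x).1 hx
    exact (hmem _).2 (hg3 f _ hd)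
  have hNK : ∀ n ∈ N, ∀ x ∈ K, n * x ∈ N := by
    intro n hn x hx
    obtain ⟨d, hd⟩ := (hmem n).1 hn
    exact (hmem _).2 ⟨_, hg1 _ hd x hx⟩
  obtain ⟨m, hm, g, g', hgg, hmg⟩ := exists_eig N hN hne
  obtain ⟨h0, h1, h2⟩ := free_step K hΔ hS N hN hNK hgg hm hmg
  let L : A →ₗ[F] A × F := (LinearMap.mulLeft F m).prod (c • counit)
  have hL : ∀ x, L x = (m * x, c * counit (R := F) x) := fun x => by simp [L]
  refine ⟨Γ ⊔ (Subalgebra.toSubmodule K).map L, le_sup_left, ⟨?_, ?_, ?_⟩, m, hm, ?_⟩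
  · intro p hp x hx
    obtain ⟨q, hq, _, ⟨y, hy, rfl⟩, rfl⟩ := Submodule.mem_sup.1 hp
    refine Submodule.mem_sup.2 ⟨_, hg1 q hq x hx, _, ⟨y * x, K.mul_mem hy hx, rfl⟩, ?_⟩
    simp [hL, add_mul, mul_assoc]
  · intro d hd
    obtain ⟨q, hq, _, ⟨y, hy, rfl⟩, he⟩ := Submodule.mem_sup.1 hd
    have e1 : q.1 + m * y = 0 := by simpa [hL] using congrArg Prod.fst he
    have hy0 : y = 0 := h2 y hy (by
      rw [eq_neg_of_add_eq_zero_right e1]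
      exact N.neg_mem ((hmem _).2 ⟨q.2, hq⟩))
    subst hy0
    rw [map_zero, add_zero] at he
    exact hg2 d (he ▸ hq)
  · intro f p hp
    obtain ⟨q, hq, _, ⟨y, hy, rfl⟩, rfl⟩ := Submodule.mem_sup.1 hp
    obtain ⟨d, hd⟩ := hg3 f q hq
    obtain ⟨d', hd'⟩ := (hmem _).1 (h1 y hy f)
    refine ⟨d + d' + c * counit (R := F) (T (f ∘ₗ LinearMap.mulLeft F g) y), Submodule.mem_sup.2 ⟨_, Γ.add_mem hd hd', _,
      ⟨T (f ∘ₗ LinearMap.mulLeft F g) y, h0 y hy _, rfl⟩, ?_⟩⟩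
    simp [hL]
    abel
  · exact Submodule.mem_sup.2 ⟨0, Γ.zero_mem, _, ⟨1, K.one_mem, rfl⟩, by simp [hL]⟩

theorem core [IsAlgClosed F] [IsCocomm F A] (K : Subalgebra F A)
    (hΔ : ∀ x ∈ K, comul (R := F) x ∈ LinearMap.range
      (TensorProduct.map (Subalgebra.toSubmodule K).subtype (Subalgebra.toSubmodule K).subtype))
    (hS : ∀ x ∈ K, antipode F x ∈ K)
    (hgen : ∀ φ : A →ₗ[F] F, (∀ a, ∀ x ∈ K, φ (a * x) = φ a * counit (R := F) x) → φ 1 = 0 →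
      φ = 0) : K = ⊤ := by
  by_contra hK
  let Γ0 : Submodule F (A × F) := (Subalgebra.toSubmodule K).prod ⊥
  have hP0 : PG K Γ0 := by
    refine ⟨?_, ?_, ?_⟩
    · rintro ⟨a, c⟩ ⟨ha, hc⟩ x hx
      have hc : c = 0 := hc
      exact ⟨K.mul_mem ha hx, by simp [hc]⟩
    · rintro c ⟨-, hc⟩
      exact hc
    · rintro f ⟨a, c⟩ ⟨ha, -⟩
      refine ⟨0, ?_, by simp⟩
      obtain ⟨r, hrl, hrr, hr⟩ := exists_T_repr _ (hΔ a ha)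
      rw [T_repr f r]
      exact Subalgebra.sum_mem _ fun i _ => K.smul_mem (hrr i) _
  have hne0 : Γ0.map (LinearMap.fst F A F) ≠ ⊤ := by
    intro h
    refine hK (Algebra.eq_top_iff.2 fun x => ?_)
    have : x ∈ Γ0.map (LinearMap.fst F A F) := h ▸ trivial
    obtain ⟨p, hp, rfl⟩ := this
    exact hp.1
  obtain ⟨Γ1, h01, hP1, m, -, hm1⟩ := extend_step K hΔ hS Γ0 hP0 hne0 1
  obtain ⟨Γ, h1Γ, hmax⟩ := zorn_le_nonempty₀ {Γ | PG K Γ} (by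
    intro C hC hch Γ' hΓ'
    have hmem : ∀ p, p ∈ sSup C ↔ ∃ Δ ∈ C, p ∈ Δ := fun p =>
      Submodule.mem_sSup_of_directed ⟨Γ', hΓ'⟩ hch.directedOn
    refine ⟨sSup C, ⟨?_, ?_, ?_⟩, fun _ h => le_sSup h⟩
    · intro p hp x hx
      obtain ⟨Δ, hΔC, hp⟩ := (hmem p).1 hp
      exact (hmem _).2 ⟨Δ, hΔC, (hC hΔC).1 p hp x hx⟩
    · intro c hc
      obtain ⟨Δ, hΔC, hp⟩ := (hmem _).1 hc
      exact (hC hΔC).2.1 c hp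
    · intro f p hp
      obtain ⟨Δ, hΔC, hp⟩ := (hmem p).1 hp
      obtain ⟨c, hc⟩ := (hC hΔC).2.2 f p hp
      exact ⟨c, (hmem _).2 ⟨Δ, hΔC, hc⟩⟩) Γ1 hP1
  have hP : PG K Γ := hmax.prop
  have htop : Γ.map (LinearMap.fst F A F) = ⊤ := by
    by_contra hne
    obtain ⟨Γ', hle, hP', m', hm', hmem'⟩ := extend_step K hΔ hS Γ hP hne 0
    exact hm' ⟨(m', 0), hmax.le_of_ge hP' hle hmem', rfl⟩
  have hex : ∀ a, ∃ c, (a, c) ∈ Γ := by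
    intro a
    have : a ∈ Γ.map (LinearMap.fst F A F) := htop ▸ trivial
    obtain ⟨p, hp, rfl⟩ := this
    exact ⟨p.2, hp⟩
  have huniq : ∀ a c d, (a, c) ∈ Γ → (a, d) ∈ Γ → c = d := by
    intro a c d hc hd
    have := Γ.sub_mem hc hd
    exact sub_eq_zero.1 (hP.2.1 _ (by simpa using this))
  choose v hv using hex
  let φ : A →ₗ[F] F :=
    { toFun := v
      map_add' := fun a b => huniq _ _ _ (hv _) (Γ.add_mem (hv a) (hv b))
      map_smul' := fun c a => huniq _ _ _ (hv _) (Γ.smul_mem c (hv a)) }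
  have h := hgen φ (fun a x hx => huniq _ _ _ (hv _) (hP.1 _ (hv a) x hx))
    (huniq _ _ _ (hv _) (h1Γ (h01 ⟨K.one_mem, rfl⟩)))
  have h1 : φ m = 1 := huniq _ _ _ (hv _) (h1Γ hm1)
  rw [h] at h1
  simp at h1

lemma antipode_antipode [IsCocomm F A] (a : A) : antipode F (antipode F a) = a := by
  have : WithConv.toConv (antipode F ∘ₗ antipode F (A := A)) = WithConv.toConv LinearMap.id := by
    apply left_inv_eq_right_inv (a := WithConv.toConv (antipode F (A := A)))
    · ext c
      have hc := comm_comul F c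
      rw [← (ℛ F c).eq, map_sum] at hc
      simp only [TensorProduct.comm_tmul] at hc
      rw [(ℛ F c).eq] at hc
      have h := congrArg (antipode F) (sum_mul_antipode_eq_smul (R := F)
        (⟨(ℛ F c).index, (ℛ F c).right, (ℛ F c).left, hc⟩ : Repr F c _))
      simp only [map_sum, antipode_mul_antidistrib, map_smul, antipode_one] at h
      rw [(ℛ F c).convMul_apply]
      simpa [Algebra.algebraMap_eq_smul_one] using h
    · exact LinearMap.antipode_mul_id
  exact congrArg (fun z => z.ofConv a) this

lemma comul_antipode [IsCocomm F A] (a : A) :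
    comul (R := F) (antipode F a) = TensorProduct.map (antipode F) (antipode F) (comul (R := F) a) := by
  have : WithConv.toConv (TensorProduct.map (antipode F) (antipode F) ∘ₗ comul (R := F) (A := A)) =
      WithConv.toConv (comul (R := F) ∘ₗ antipode F (A := A)) := by
    apply left_inv_eq_right_inv (a := WithConv.toConv (comul (R := F) (A := A)))
    · have h := LinearMap.antipode_mul_id (R := F) (C := A ⊗[F] A)
      let D := Bialgebra.comulBialgHom F A
      ext c
      have h2 := congrArg (fun z => z.ofConv (comul (R := F) c)) h
      have hD : comul (R := F) (comul (R := F) c) = TensorProduct.map comul comul (comul (R := F) c) :=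
        (CoalgHomClass.map_comp_comul_apply D c).symm
      simp only [LinearMap.convMul_def, hD, LinearMap.comp_apply] at h2
      rw [← (ℛ F c).eq] at h2
      rw [(ℛ F c).convMul_apply]
      simp [map_sum] at h2 ⊢
      refine h2.trans ?_
      rw [← TensorProduct.sum_tmul]
      simp only [← map_mul, ← map_sum]
      have h3 := congrArg (counit (R := F)) (sum_counit_smul (ℛ F c))
      simp only [map_sum, map_smul, smul_eq_mul] at h3
      rw [← h3]
      simp only [mul_comm]
    · exact LinearMap.comul_right_inv
  exact (congrArg (fun z => z.ofConv a) this).symm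

lemma range_map {V W : Submodule F A} (f : A →ₗ[F] A) (h : ∀ v ∈ V, f v ∈ W) {z : A ⊗[F] A}
    (hz : z ∈ LinearMap.range (TensorProduct.map V.subtype V.subtype)) :
    TensorProduct.map f f z ∈ LinearMap.range (TensorProduct.map W.subtype W.subtype) := by
  obtain ⟨y, rfl⟩ := hz
  refine ⟨TensorProduct.map (f.restrict h) (f.restrict h) y, ?_⟩
  rw [← LinearMap.comp_apply, ← LinearMap.comp_apply, ← TensorProduct.map_comp,
    ← TensorProduct.map_comp]
  rfl

lemma exists_fd [IsCocomm F A] (s : Finset A) : ∃ V : Submodule F A, FiniteDimensional F V ∧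
    (∀ a ∈ s, a ∈ V) ∧ (∀ f : A →ₗ[F] F, ∀ x ∈ V, T f x ∈ V) := by
  classical
  induction s using Finset.induction_on with
  | empty => exact ⟨⊥, inferInstance, by simp, by simp⟩
  | insert a s _ ih =>
    obtain ⟨V, h1, h2, h3⟩ := ih
    obtain ⟨W, w1, w2, w3, -⟩ := fin_T (F := F) a
    refine ⟨W ⊔ V, inferInstance, ?_, ?_⟩
    · intro b hb
      rcases Finset.mem_insert.1 hb with rfl | hb
      · exact Submodule.mem_sup_left w2
      · exact Submodule.mem_sup_right (h2 b hb)
    · intro f x hx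
      obtain ⟨w, hw, v, hv, rfl⟩ := Submodule.mem_sup.1 hx
      rw [map_add]
      exact Submodule.add_mem_sup (w3 f w hw) (h3 f v hv)

lemma exists_fg_hopf [IsCocomm F A] (s : Finset A) : ∃ K : Subalgebra F A, K.FG ∧
    (∀ a ∈ s, a ∈ K) ∧
    (∀ x ∈ K, comul (R := F) x ∈ LinearMap.range
      (TensorProduct.map (Subalgebra.toSubmodule K).subtype (Subalgebra.toSubmodule K).subtype)) ∧
    (∀ x ∈ K, antipode F x ∈ K) := by
  classical
  obtain ⟨V, h1, h2, h3⟩ := exists_fd (F := F) s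
  obtain ⟨t, ht⟩ := (Submodule.fg_iff_finiteDimensional V).2 h1
  let G : Finset A := t ∪ t.image (antipode F)
  let K := Algebra.adjoin F (G : Set A)
  have htV : ∀ x ∈ t, x ∈ V := fun x hx => ht ▸ Submodule.subset_span hx
  have hVK : V ≤ Subalgebra.toSubmodule K := by
    rw [← ht, Submodule.span_le]
    intro x hx
    exact Algebra.subset_adjoin (by simp [G]; exact Or.inl hx)
  have hSVK : V ≤ (Subalgebra.toSubmodule K).comap (antipode F) := by
    rw [← ht, Submodule.span_le]
    intro x hx
    exact Algebra.subset_adjoin (by simp only [G, Finset.coe_union, Finset.coe_image]; exact Or.inr ⟨x, hx, rfl⟩)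
  refine ⟨K, ⟨G, rfl⟩, fun a ha => hVK (h2 a ha), ?_, ?_⟩
  · have : K ≤ ((Algebra.TensorProduct.map K.val K.val).range).comap (Bialgebra.comulAlgHom F A) := by
      refine Algebra.adjoin_le fun x hx => ?_
      suffices comul (R := F) x ∈ LinearMap.range
        (TensorProduct.map (Subalgebra.toSubmodule K).subtype (Subalgebra.toSubmodule K).subtype) by
        obtain ⟨y, hy⟩ := this
        exact ⟨y, hy⟩
      simp only [G, Finset.coe_union, Finset.coe_image] at hx
      rcases hx with hx | ⟨x, hx, rfl⟩
      · have := range_map LinearMap.id hVK (comul_mem_range V h3 (htV x hx))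
        simpa using this
      · rw [comul_antipode]
        exact range_map _ hSVK (comul_mem_range V h3 (htV x hx))
    intro x hx
    obtain ⟨y, hy⟩ := this hx
    exact ⟨y, hy⟩
  · intro x hx
    induction hx using Algebra.adjoin_induction with
    | mem x hx =>
      simp only [G, Finset.coe_union, Finset.coe_image] at hx
      rcases hx with hx | ⟨x, hx, rfl⟩
      · exact hSVK (htV x hx)
      · rw [antipode_antipode]; exact hVK (htV x hx)
    | algebraMap r =>
      rw [Algebra.algebraMap_eq_smul_one, map_smul, antipode_one]
      exact K.smul_mem K.one_mem _
    | add x y _ _ hx hy => rw [map_add]; exact K.add_mem hx hy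
    | mul x y _ _ hx hy => rw [antipode_mul_antidistrib]; exact K.mul_mem hy hx
end

section
variable {k H : Type*} [Field k] [Ring H] [HopfAlgebra k H]

lemma descend [IsCocomm k H] (K : Subalgebra k H)
    (hΔ : ∀ x ∈ K, comul (R := k) x ∈ LinearMap.range
      (TensorProduct.map (Subalgebra.toSubmodule K).subtype (Subalgebra.toSubmodule K).subtype))
    (hS : ∀ x ∈ K, antipode k x ∈ K) (s : Finset H) (hs : ∀ a ∈ s, a ∈ K)
    (hspan : Ideal.span (s : Set H) = RingHom.ker (Bialgebra.counitAlgHom k H)) : K = ⊤ := by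
  let F := AlgebraicClosure k
  have htop : K.baseChange F = ⊤ := by
    have hin : ∀ (c : F), ∀ x ∈ K, c ⊗ₜ[k] x ∈ K.baseChange F := fun c x hx =>
      Subalgebra.tmul_mem_baseChange hx c
    have hind : ∀ {P : F ⊗[k] H → Prop}, P 0 → (∀ x y, P x → P y → P (x + y)) →
        (∀ (c : F), ∀ x ∈ K, P (c ⊗ₜ x)) → ∀ z ∈ K.baseChange F, P z := by
      rintro P h0 ha ht z ⟨w, rfl⟩
      change P (Algebra.TensorProduct.map (AlgHom.id F F) K.val w)
      induction w with
      | zero => simpa using h0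
      | add x y hx hy => rw [map_add]; exact ha _ _ hx hy
      | tmul c x => exact ht c x x.2
    apply core
    · apply hind
      · rw [map_zero]; exact Submodule.zero_mem _
      · intro x y hx hy; rw [map_add]; exact Submodule.add_mem _ hx hy
      · intro c x hx
        obtain ⟨y, hy⟩ := hΔ x hx
        rw [TensorProduct.comul_tmul, ← hy]
        clear hy
        induction y with
        | zero => simp
        | add u v hu hv => rw [map_add, tmul_add, map_add]; exact Submodule.add_mem _ hu hv
        | tmul u v =>
          exact ⟨⟨1 ⊗ₜ (u : H), hin 1 u u.2⟩ ⊗ₜ ⟨c ⊗ₜ (v : H), hin c v v.2⟩, by simp⟩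
    · apply hind
      · rw [map_zero]; exact Subalgebra.zero_mem _
      · intro x y hx hy; rw [map_add]; exact Subalgebra.add_mem _ hx hy
      · intro c x hx
        exact hin c _ (hS x hx)
    · intro φ hφ h1
      have key : ∀ a ∈ Ideal.span (s : Set H), ∀ b : H, φ (1 ⊗ₜ (b * a)) = 0 := by
        intro a ha
        induction ha using Submodule.span_induction with
        | mem x hx =>
          intro b
          have h2 := hφ (1 ⊗ₜ b) (1 ⊗ₜ x) (hin 1 x (hs x hx))
          have hx0 : counit (R := k) x = 0 := by
            have : x ∈ RingHom.ker (Bialgebra.counitAlgHom k H) := hspan ▸ Ideal.subset_span hx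
            exact this
          simpa [hx0] using h2
        | zero => intro b; simp
        | add x y _ _ hx hy => intro b; rw [mul_add, tmul_add, map_add, hx, hy, add_zero]
        | smul r x _ hx => intro b; rw [smul_eq_mul, ← mul_assoc]; exact hx _
      ext a
      have h3 := key (a - algebraMap k H (counit a)) (by
        rw [hspan, RingHom.mem_ker]; simp) 1
      rw [one_mul, tmul_sub, map_sub, Algebra.algebraMap_eq_smul_one, tmul_smul] at h3
      have h4 : φ (counit (R := k) a • (1 : F) ⊗ₜ[k] (1 : H)) = 0 := by
        rw [← algebraMap_smul F, map_smul]
        erw [h1]; simp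
      rw [h4, sub_zero] at h3
      simpa using h3
  by_contra hK
  have : ∃ a, a ∉ K := by
    by_contra! h
    exact hK (Algebra.eq_top_iff.2 h)
  obtain ⟨a, ha⟩ := this
  obtain ⟨f, hfa, hf⟩ := Submodule.exists_le_ker_of_notMem (p := Subalgebra.toSubmodule K) (v := a) ha
  have h0 : ∀ z ∈ K.baseChange F, f.baseChange F z = 0 := by
    rintro _ ⟨w, rfl⟩
    change f.baseChange F (Algebra.TensorProduct.map (AlgHom.id F F) K.val w) = 0
    induction w with
    | zero => simp
    | add x y hx hy => rw [map_add, map_add, hx, hy, add_zero]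
    | tmul c x =>
      have : f (x : H) = 0 := hf x.2
      simp [this]
  have h1 := h0 (1 ⊗ₜ a) (htop ▸ trivial)
  have h2 := congrArg (TensorProduct.rid k F) h1
  simp at h2
  exact hfa h2
end
end Molnar

/-- Molnar: a cocommutative noetherian Hopf algebra over a field is affine. -/
theorem cocommutative_hopfAlgebra_noetherian_finiteType
    (k H : Type*) [Field k] [Ring H] [HopfAlgebra k H]
    (hcocomm : ∀ x : H,
      (TensorProduct.comm k H H) (Coalgebra.comul (R := k) x) =
        Coalgebra.comul (R := k) x)
    (hnoeth : IsNoetherianRing H) :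
    Algebra.FiniteType k H := by
  have : Coalgebra.IsCocomm k H := ⟨LinearMap.ext hcocomm⟩
  obtain ⟨s, hs⟩ := (isNoetherian_def.1 hnoeth) (RingHom.ker (Bialgebra.counitAlgHom k H))
  obtain ⟨K, hfg, hsK, hΔ, hS⟩ := Molnar.exists_fg_hopf (F := k) s
  have := Molnar.descend K hΔ hS s hsK hs
  exact ⟨this ▸ hfg⟩
end

section
/- Let k be a field and let H be a Hopf algebra over k. Then H is an Artinian ring if and only if H is finite dimensional as a k-vector space. -/
open TensorProduct Coalgebra HopfAlgebra

section
variable {k H : Type*} [Field k] [Ring H] [HopfAlgebra k H]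

lemma aux_I1 (g : H) :
    (LinearMap.lTensor H (LinearMap.mul' k H ∘ₗ LinearMap.lTensor H (antipode k)))
      (TensorProduct.assoc k H H H ((LinearMap.rTensor H (comul (R := k))) (comul (R := k) g)))
      = g ⊗ₜ[k] (1 : H) := by
  rw [Coalgebra.coassoc_apply, ← LinearMap.comp_apply, ← LinearMap.lTensor_comp,
    LinearMap.comp_assoc, HopfAlgebra.mul_antipode_lTensor_comul, LinearMap.lTensor_comp,
    LinearMap.comp_apply, Coalgebra.lTensor_counit_comul]
  simp

lemma aux_I2 (r : H) :
    (LinearMap.rTensor H (LinearMap.mul' k H ∘ₗ LinearMap.lTensor H (antipode k)))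
      ((TensorProduct.assoc k H H H).symm
        ((LinearMap.lTensor H (comul (R := k))) (comul (R := k) r)))
      = (1 : H) ⊗ₜ[k] r := by
  rw [Coalgebra.coassoc_symm_apply, ← LinearMap.comp_apply, ← LinearMap.rTensor_comp,
    LinearMap.comp_assoc, HopfAlgebra.mul_antipode_lTensor_comul, LinearMap.rTensor_comp,
    LinearMap.comp_apply, Coalgebra.rTensor_counit_comul]
  simp

lemma aux_I1' (g : H) {ι : Type*} (rp : Coalgebra.Repr k g ι) :
    ∑ i ∈ rp.index, comul (R := k) (rp.left i) * ((1 : H) ⊗ₜ[k] antipode k (rp.right i))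
      = g ⊗ₜ[k] (1 : H) := by
  rw [← aux_I1 (k := k) g, ← rp.eq, map_sum, map_sum, map_sum]
  refine Finset.sum_congr rfl fun i _ => ?_
  rw [LinearMap.rTensor_tmul]
  induction comul (R := k) (rp.left i) with
  | zero => simp
  | add x y hx hy => simp only [add_mul, hx, hy, add_tmul, map_add]
  | tmul x y => simp

/-- slices -/
noncomputable def slice (φ : H →ₗ[k] k) : H ⊗[k] H →ₗ[k] H :=
  (TensorProduct.rid k H).toLinearMap ∘ₗ LinearMap.lTensor H φ

lemma slice_tmul (φ : H →ₗ[k] k) (a b : H) : slice φ (a ⊗ₜ[k] b) = φ b • a := by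
  simp [slice]

lemma exists_C (R : Submodule k H) [FiniteDimensional k R] :
    ∃ C : Submodule k H, FiniteDimensional k C ∧
      ∀ x ∈ R, ∀ φ : H →ₗ[k] k, slice φ (comul (R := k) x) ∈ C := by
  have hone : ∀ t : H ⊗[k] H, ∃ C : Submodule k H, FiniteDimensional k C ∧
      ∀ φ : H →ₗ[k] k, slice φ t ∈ C := by
    intro t
    induction t with
    | zero => exact ⟨⊥, inferInstance, by simp⟩
    | tmul a b =>
      refine ⟨k ∙ a, inferInstance, fun φ => ?_⟩
      rw [slice_tmul]
      exact Submodule.smul_mem _ _ (Submodule.mem_span_singleton_self a)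
    | add x y hx hy =>
      obtain ⟨C, hC, h⟩ := hx
      obtain ⟨D, hD, h'⟩ := hy
      refine ⟨C ⊔ D, inferInstance, fun φ => ?_⟩
      rw [map_add]
      exact Submodule.add_mem_sup (h φ) (h' φ)
  choose D hD hD' using hone
  obtain ⟨s, hs⟩ := (Submodule.fg_iff_finiteDimensional R).2 inferInstance
  refine ⟨⨆ x : s, D (comul (R := k) (x : H)), inferInstance, fun x hx φ => ?_⟩
  rw [← hs] at hx
  induction hx using Submodule.span_induction with
  | mem x hx => exact Submodule.mem_iSup_of_mem (⟨x, hx⟩ : s) (hD' _ φ)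
  | zero => simp
  | add x y _ _ hx hy => rw [map_add, map_add]; exact Submodule.add_mem _ hx hy
  | smul a x _ hx => rw [map_smul, map_smul]; exact Submodule.smul_mem _ _ hx

lemma finite_of_rightIdeal (R : Submodule k H) [FiniteDimensional k R]
    (hR : ∀ x ∈ R, ∀ h : H, x * h ∈ R) (r : H) (hr : r ∈ R) (hr0 : r ≠ 0) :
    FiniteDimensional k H := by
  obtain ⟨C, hC, hCs⟩ := exists_C R
  let B := Module.Basis.ofVectorSpace k H
  obtain ⟨c, hc⟩ := TensorProduct.eq_repr_basis_right B (comul (R := k) r)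
  have key : ∀ g i, c i * g ∈ C := by
    intro g j
    have h1 : comul (R := k) r * (g ⊗ₜ[k] (1 : H)) =
        ∑ i ∈ (ℛ k g).index, comul (R := k) (r * (ℛ k g).left i) *
          ((1 : H) ⊗ₜ[k] antipode k ((ℛ k g).right i)) := by
      rw [← aux_I1' g (ℛ k g), Finset.mul_sum]
      simp [Bialgebra.comul_mul, mul_assoc]
    have h2 : slice (B.coord j) (comul (R := k) r * (g ⊗ₜ[k] (1 : H))) = c j * g := by
      rw [← hc, Finsupp.sum, Finset.sum_mul, map_sum]
      simp only [Algebra.TensorProduct.tmul_mul_tmul, mul_one, slice_tmul, Module.Basis.coord_apply,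
        Module.Basis.repr_self]
      rw [Finset.sum_eq_single j]
      · simp
      · intro b _ hb
        simp [hb]
      · intro h
        simp [Finsupp.notMem_support_iff.1 h]
    rw [← h2, h1, map_sum]
    refine Submodule.sum_mem _ fun i _ => ?_
    have h3 : ∀ (t : H ⊗[k] H) (b : H), slice (B.coord j) (t * ((1 : H) ⊗ₜ[k] b)) =
        slice (B.coord j ∘ₗ LinearMap.mulRight k b) t := by
      intro t b
      induction t with
      | zero => simp
      | add x y hx hy => simp only [add_mul, map_add, hx, hy]
      | tmul x y => simp [slice_tmul]
    rw [h3]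
    exact hCs _ (hR _ hr _) _
  obtain ⟨j, hj⟩ : ∃ j, B.coord j r ≠ 0 := by
    by_contra! hcon
    exact hr0 (B.forall_coord_eq_zero_iff.1 hcon)
  have htop : C = ⊤ := by
    refine eq_top_iff.2 fun h _ => ?_
    have h1 : ∀ (a : H) (_ : ∀ g, a * g ∈ C) (t : H ⊗[k] H),
        slice (B.coord j) ((LinearMap.rTensor H (LinearMap.mul' k H ∘ₗ
          LinearMap.lTensor H (antipode k))) ((TensorProduct.assoc k H H H).symm
          (a ⊗ₜ[k] t))) * h ∈ C := by
      intro a ha t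
      induction t with
      | zero => simp
      | add x y hx hy => simp only [tmul_add, map_add, add_mul]; exact Submodule.add_mem _ hx hy
      | tmul x y =>
        simp only [TensorProduct.assoc_symm_tmul, LinearMap.rTensor_tmul, LinearMap.comp_apply,
          LinearMap.lTensor_tmul, LinearMap.mul'_apply, slice_tmul, smul_mul_assoc, mul_assoc]
        exact Submodule.smul_mem _ _ (ha _)
    have h2 := congrArg (fun t => slice (B.coord j) t * h) (aux_I2 (k := k) r)
    simp only [slice_tmul, smul_mul_assoc, one_mul] at h2
    have h3 : B.coord j r • h ∈ C := by
      rw [← h2, ← hc, Finsupp.sum]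
      simp only [map_sum, LinearMap.lTensor_tmul, Finset.sum_mul]
      exact Submodule.sum_mem _ fun i _ => h1 _ (fun g => key g i) _
    exact (Submodule.smul_mem_iff _ hj).1 h3
  rw [htop] at hC
  exact Module.Finite.equiv (Submodule.topEquiv (R := k) (M := H))

lemma exists_e [IsArtinianRing H] : ∃ e : H, counit (R := k) e = 1 ∧
    ∀ x : H, counit (R := k) x = 0 → e * x ∈ Ring.jacobson H := by
  let ε : H →+* k := (Bialgebra.counitAlgHom k H : H →+* k)
  have hε : ∀ x, ε x = counit (R := k) x := fun _ => rfl
  have hsurj : Function.Surjective ε := fun a => ⟨algebraMap k H a, by simp [hε]⟩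
  have hmax : (RingHom.ker ε).IsMaximal := RingHom.ker_isMaximal_of_surjective ε hsurj
  have hJ : Ring.jacobson H ≤ RingHom.ker ε := Ring.jacobson_le_of_isMaximal _
  let ε' : H ⧸ Ring.jacobson H →+* k := Ideal.Quotient.lift _ ε (fun a ha => hJ ha)
  obtain ⟨N, hN⟩ := exists_isCompl (RingHom.ker (RingHom.op ε'))
  have h1 : (1 : (H ⧸ Ring.jacobson H)ᵐᵒᵖ) ∈ RingHom.ker (RingHom.op ε') ⊔ N := by
    rw [hN.sup_eq_top]; trivial
  obtain ⟨a, ha, n, hn, han⟩ := Submodule.mem_sup.1 h1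
  obtain ⟨e, he⟩ := Ideal.Quotient.mk_surjective n.unop
  have ha' : ε' a.unop = 0 := by
    have := (RingHom.mem_ker).1 ha
    simpa using this
  refine ⟨e, ?_, fun x hx => ?_⟩
  · have h2 : ε' a.unop + ε' n.unop = 1 := by
      rw [← map_add, ← MulOpposite.unop_add, han]; simp
    rw [ha', zero_add, ← he] at h2
    exact h2
  · rw [← Ideal.Quotient.eq_zero_iff_mem, map_mul, he]
    have h3 : MulOpposite.op (Ideal.Quotient.mk (Ring.jacobson H) x) * n ∈
        RingHom.ker (RingHom.op ε') ⊓ N := by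
      refine ⟨?_, N.mul_mem_left _ hn⟩
      have : ε' (Ideal.Quotient.mk (Ring.jacobson H) x) = 0 := hx
      change _ ∈ RingHom.ker _
      rw [RingHom.mem_ker, map_mul]
      simp [this]
    rw [hN.inf_eq_bot, Submodule.mem_bot] at h3
    simpa using congrArg MulOpposite.unop h3

lemma exists_F [IsArtinianRing H] (e : H)
    (he : ∀ x : H, counit (R := k) x = 0 → e * x ∈ Ring.jacobson H) (i : ℕ) :
    ∃ F : Submodule k H, FiniteDimensional k F ∧
      ∀ x ∈ Ring.jacobson H ^ i, e * x ∈ F ⊔ (Ring.jacobson H ^ (i + 1)).restrictScalars k := by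
  obtain ⟨s, hs⟩ := (isNoetherian_def.1 (inferInstance : IsNoetherian H H))
    (Ring.jacobson H ^ i)
  classical
  refine ⟨Submodule.span k (s.image (e * ·) : Finset H), inferInstance, fun x hx => ?_⟩
  rw [← hs] at hx
  induction hx using Submodule.span_induction with
  | mem x hx =>
    refine Submodule.mem_sup_left (Submodule.subset_span ?_)
    exact Finset.mem_coe.2 (Finset.mem_image_of_mem _ hx)
  | zero => simp
  | add x y _ _ hx hy => rw [mul_add]; exact Submodule.add_mem _ hx hy
  | smul h x hx ih =>
    have : e * (h • x) = counit (R := k) h • (e * x) +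
        (e * (h - algebraMap k H (counit (R := k) h))) * x := by
      simp only [smul_eq_mul, mul_sub, sub_mul, mul_assoc, Algebra.smul_def]
      rw [Algebra.left_comm]
      abel
    rw [this]
    refine Submodule.add_mem _ (Submodule.smul_mem _ _ ih) (Submodule.mem_sup_right ?_)
    rw [Submodule.restrictScalars_mem, Ideal.IsTwoSided.pow_succ]
    refine Ideal.mul_mem_mul (he _ (by simp)) ?_
    rw [← hs]; exact hx

lemma exists_F' [IsArtinianRing H] (e : H)
    (he : ∀ x : H, counit (R := k) x = 0 → e * x ∈ Ring.jacobson H) (i : ℕ) :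
    ∃ F : Submodule k H, FiniteDimensional k F ∧
      ∀ x, e ^ i * x ∈ F ⊔ (Ring.jacobson H ^ i).restrictScalars k := by
  induction i with
  | zero =>
    refine ⟨⊥, inferInstance, fun x => Submodule.mem_sup_right ?_⟩
    rw [Submodule.restrictScalars_mem, Submodule.pow_zero, Ideal.one_eq_top]; trivial
  | succ i ih =>
    obtain ⟨F, hF, h⟩ := ih
    obtain ⟨G, hG, h'⟩ := exists_F (k := k) e he i
    refine ⟨F.map (LinearMap.mulLeft k e) ⊔ G, inferInstance, fun x => ?_⟩
    obtain ⟨f, hf, y, hy, hfy⟩ := Submodule.mem_sup.1 (h x)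
    rw [pow_succ', mul_assoc, ← hfy, mul_add, sup_assoc]
    exact Submodule.add_mem_sup (Submodule.mem_map_of_mem (f := LinearMap.mulLeft k e) hf) (h' y hy)

end

/-- Liu–Zhang: a Hopf algebra over a field is Artinian iff it is finite dimensional. -/
theorem hopfAlgebra_isArtinianRing_iff_finiteDimensional
    (k H : Type*) [Field k] [Ring H] [HopfAlgebra k H] :
    IsArtinianRing H ↔ FiniteDimensional k H := by
  refine ⟨fun _ => ?_, fun _ => IsArtinianRing.of_finite k H⟩
  obtain ⟨e, he1, he⟩ := exists_e (k := k) (H := H)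
  obtain ⟨n, hn⟩ := IsSemiprimaryRing.isNilpotent (R := H)
  obtain ⟨F, hF, h⟩ := exists_F' (k := k) e he n
  have hle : LinearMap.range (LinearMap.mulLeft k (e ^ n)) ≤ F := by
    rintro _ ⟨x, rfl⟩
    have := h x
    rw [hn] at this
    simpa using this
  have hfin : FiniteDimensional k (LinearMap.range (LinearMap.mulLeft k (e ^ n))) :=
    Submodule.finiteDimensional_of_le hle
  refine finite_of_rightIdeal (LinearMap.range (LinearMap.mulLeft k (e ^ n))) ?_ (e ^ n)
    ⟨1, by simp⟩ ?_
  · rintro _ ⟨x, rfl⟩ g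
    exact ⟨x * g, by simp [mul_assoc]⟩
  · intro h0
    have h1 := congrArg (Bialgebra.counitAlgHom k H) h0
    rw [map_pow, map_zero] at h1
    simp [he1] at h1
end

section
/- Let k be a field of characteristic 0 and let W be the Witt Lie algebra over k, realized as the Lie algebra of all k-linear derivations of the Laurent polynomial ring k[t, t⁻¹] (equivalently, the Lie algebra with basis {eₙ : n ∈ ℤ} and bracket [eᵢ, eⱼ] = (j − i)e_{i+j}). Then the universal enveloping algebra U(W) is not a noetherian ring. -/
namespace WittNN

open LaurentPolynomial

attribute [local instance 100] LieRing.ofAssociativeRing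

noncomputable section

variable {k : Type*} [Field k]

/-- Euler operator `T d/dT`. -/
def eulerLin (R : Type*) [CommRing R] : R[T;T⁻¹] →ₗ[R] R[T;T⁻¹] where
  toFun p := .ofCoeff (Finsupp.onFinset p.coeff.support (fun n => (n : R) * p.coeff n) (by
    intro n hn
    rw [Finsupp.mem_support_iff]
    intro h
    exact hn (by rw [h, mul_zero])))
  map_add' p q := by ext n; simp [mul_add]
  map_smul' r p := by ext n; simp [mul_left_comm]

lemma coeff_euler {R : Type*} [CommRing R] (p : R[T;T⁻¹]) (n : ℤ) :
    (eulerLin R p).coeff n = (n : R) * p.coeff n := rfl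

lemma euler_CT {R : Type*} [CommRing R] (r : R) (n : ℤ) :
    eulerLin R (C r * T n) = (n : R[T;T⁻¹]) * (C r * T n) := by
  have : ((n : ℤ) : R[T;T⁻¹]) = C (n : R) := by simp
  rw [this, ← mul_assoc, ← map_mul, ← single_eq_C_mul_T, ← single_eq_C_mul_T]
  ext m
  rw [coeff_euler, AddMonoidAlgebra.coeff_single, AddMonoidAlgebra.coeff_single,
    Finsupp.single_apply, Finsupp.single_apply]
  split_ifs with h
  · rw [h]
  · simp

lemma euler_T {R : Type*} [CommRing R] (n : ℤ) :
    eulerLin R (T n) = (n : R[T;T⁻¹]) * T n := by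
  simpa using euler_CT (1 : R) n

lemma euler_mul {R : Type*} [CommRing R] (p q : R[T;T⁻¹]) :
    eulerLin R (p * q) = p * eulerLin R q + eulerLin R p * q := by
  induction p using LaurentPolynomial.induction_on' with
  | add p p' h h' => rw [add_mul, map_add, h, h', map_add]; ring
  | C_mul_T n r =>
    induction q using LaurentPolynomial.induction_on' with
    | add p p' h h' => rw [mul_add, map_add, h, h', map_add]; ring
    | C_mul_T m s =>
      have : C r * T n * (C s * T m) = C (r * s) * T (n + m) := by
        rw [T_add, map_mul]; ring
      rw [this, euler_CT, euler_CT, euler_CT, T_add, map_mul]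
      push_cast
      ring

/-- base change -/
def bc (k R : Type*) [Field k] [CommRing R] [Algebra k R] : k[T;T⁻¹] →+* R[T;T⁻¹] :=
  AddMonoidAlgebra.mapRingHom ℤ (algebraMap k R)

variable {R : Type*} [CommRing R] [Algebra k R]

lemma bc_T (n : ℤ) : bc k R (T n) = T n := by
  simp only [bc, T, AddMonoidAlgebra.mapRingHom_single, map_one]

lemma bc_euler (p : k[T;T⁻¹]) : bc k R (eulerLin k p) = eulerLin R (bc k R p) := by
  ext n
  rw [coeff_euler]
  simp [bc, coeff_euler]

lemma bc_smul (c : k) (p : k[T;T⁻¹]) : bc k R (c • p) = c • bc k R p := by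
  ext n
  have : ∀ q : k[T;T⁻¹], (bc k R q).coeff n = algebraMap k R (q.coeff n) := fun q => by simp [bc]
  rw [AddMonoidAlgebra.coeff_smul_apply, this, this, AddMonoidAlgebra.coeff_smul_apply,
    smul_eq_mul, map_mul, Algebra.smul_def]

/-- symbol of a derivation -/
def sym (D : Derivation k k[T;T⁻¹] k[T;T⁻¹]) : k[T;T⁻¹] := T (-1) * D (T 1)

/-- Euler as derivation -/
def eulerDer (k : Type*) [Field k] : Derivation k k[T;T⁻¹] k[T;T⁻¹] :=
  Derivation.mk' (eulerLin k) (fun a b => by rw [euler_mul]; simp only [smul_eq_mul]; ring)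

lemma eulerDer_apply (p : k[T;T⁻¹]) : eulerDer k p = eulerLin k p := rfl

lemma T_one_neg : (T 1 : k[T;T⁻¹]) * T (-1) = 1 := by rw [← T_add]; simp

lemma T_neg_one : (T (-1) : k[T;T⁻¹]) * T 1 = 1 := by rw [← T_add]; simp

lemma der_ext (D E : Derivation k k[T;T⁻¹] k[T;T⁻¹]) (h : D (T 1) = E (T 1)) : D = E := by
  have h' : D (T (-1)) = E (T (-1)) := by
    rw [D.leibniz_of_mul_eq_one T_neg_one, E.leibniz_of_mul_eq_one T_neg_one, h]
  ext1 p
  induction p using LaurentPolynomial.induction_on with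
  | h_C a => rw [C_eq_algebraMap]; simp only [Derivation.map_algebraMap]
  | h_add hp hq => rw [map_add, map_add, hp, hq]
  | h_C_mul_T n a ih =>
    rw [T_add, ← mul_assoc, D.leibniz, E.leibniz, ih, h]
  | h_C_mul_T_Z n a ih =>
    rw [sub_eq_add_neg, T_add, ← mul_assoc, D.leibniz, E.leibniz, ih, h']

lemma der_eq (D : Derivation k k[T;T⁻¹] k[T;T⁻¹]) (p : k[T;T⁻¹]) :
    D p = sym D * eulerLin k p := by
  have : D = sym D • eulerDer k := by
    apply der_ext
    rw [Derivation.smul_apply, eulerDer_apply, euler_T, sym, smul_eq_mul]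
    linear_combination (-D (T 1)) * T_one_neg (k := k)
  conv_lhs => rw [this]
  rfl

lemma sym_lie (D E : Derivation k k[T;T⁻¹] k[T;T⁻¹]) :
    sym ⁅D, E⁆ = sym D * eulerLin k (sym E) - sym E * eulerLin k (sym D) := by
  have h1 : ∀ F : Derivation k k[T;T⁻¹] k[T;T⁻¹], F (T 1) = sym F * T 1 := fun F => by
    rw [sym]; linear_combination (-F (T 1)) * T_one_neg (k := k)
  conv_lhs => rw [sym, Derivation.commutator_apply, h1 D, h1 E, der_eq D, der_eq E, euler_mul,
    euler_mul]
  linear_combination (sym D * eulerLin k (sym E) - sym E * eulerLin k (sym D)) * T_one_neg (k := k)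

/-- the operator of a symbol -/
def op (k : Type*) [Field k] {R : Type*} [CommRing R] [Algebra k R] (a x : R) (F : R[T;T⁻¹]) :
    Module.End k R[T;T⁻¹] where
  toFun g := F * eulerLin R g + C x * F * g + C a * eulerLin R F * g
  map_add' p q := by rw [map_add]; ring
  map_smul' c p := by
    rw [LinearMap.map_smul_of_tower, RingHom.id_apply, mul_smul_comm, mul_smul_comm,
      mul_smul_comm, smul_add, smul_add]

lemma op_apply (a x : R) (F g : R[T;T⁻¹]) :
    op k a x F g = F * eulerLin R g + C x * F * g + C a * eulerLin R F * g := rfl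

lemma euler_C_mul (r : R) (p : R[T;T⁻¹]) : eulerLin R (C r * p) = C r * eulerLin R p := by
  rw [← smul_eq_C_mul, map_smul, smul_eq_C_mul]

lemma euler_C (r : R) : eulerLin R (C r) = 0 := by
  simpa using euler_CT r 0

/-- the representation -/
def rep (k : Type*) [Field k] {R : Type*} [CommRing R] [Algebra k R] (a x : R) : Derivation k k[T;T⁻¹] k[T;T⁻¹] →ₗ⁅k⁆ Module.End k R[T;T⁻¹] where
  toFun D := op k a x (bc k R (sym D))
  map_add' D E := by
    refine LinearMap.ext fun g => ?_
    have : sym (D + E) = sym D + sym E := by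
      simp only [sym, Derivation.add_apply, mul_add]
    rw [this, LinearMap.add_apply]
    simp only [op_apply, map_add]
    ring
  map_smul' c D := by
    refine LinearMap.ext fun g => ?_
    have : sym (c • D) = c • sym D := by
      simp only [sym, Derivation.smul_apply, mul_smul_comm]
    rw [this, bc_smul, RingHom.id_apply, LinearMap.smul_apply]
    simp only [op_apply, LinearMap.map_smul_of_tower, smul_add, mul_smul_comm, smul_mul_assoc]
  map_lie' {D E} := by
    refine LinearMap.ext fun g => ?_
    rw [LieRing.of_associative_ring_bracket, sym_lie]
    simp only [LinearMap.sub_apply, Module.End.mul_apply, op_apply, map_sub, map_mul, map_add,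
      bc_euler, euler_mul, euler_C]
    ring

lemma rep_apply (a x : R) (D : Derivation k k[T;T⁻¹] k[T;T⁻¹]) (g : R[T;T⁻¹]) :
    rep k a x D g = bc k R (sym D) * eulerLin R g + C x * bc k R (sym D) * g
      + C a * eulerLin R (bc k R (sym D)) * g := rfl

/-- basis vectors of the Witt algebra -/
def e (k : Type*) [Field k] (n : ℤ) : Derivation k k[T;T⁻¹] k[T;T⁻¹] := (T n : k[T;T⁻¹]) • eulerDer k

lemma sym_e (n : ℤ) : sym (e k n) = T n := by
  rw [sym, e, Derivation.smul_apply, eulerDer_apply, euler_T, smul_eq_mul]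
  push_cast
  linear_combination (T n) * T_one_neg (k := k)

lemma rep_e (a x : R) (n m : ℤ) : rep k a x (e k n) (T m) = C (x + m + n * a) * T (n + m) := by
  rw [rep_apply, sym_e, bc_T, euler_T, euler_T, T_add]
  simp only [map_add, map_mul, map_intCast]
  ring

lemma rep_C_mul (a x r : R) (D : Derivation k k[T;T⁻¹] k[T;T⁻¹]) (g : R[T;T⁻¹]) :
    rep k a x D (C r * g) = C r * rep k a x D g := by
  rw [rep_apply, rep_apply, euler_C_mul]; ring

/-- The module of filtration `n`. -/
def filt (k : Type*) [Field k] {R : Type*} [CommRing R] [Algebra k R]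
    (h : R) (ev : ℤ → R →ₐ[k] k) (n : ℕ) : Submodule k R[T;T⁻¹] where
  carrier := {f | ∃ m : R[T;T⁻¹], f = C h * m ∧ ∀ i : ℤ, n ≤ i → ev i (m.coeff i) = 0}
  zero_mem' := ⟨0, by simp, by simp⟩
  add_mem' := by
    rintro _ _ ⟨m, rfl, hm⟩ ⟨m', rfl, hm'⟩
    exact ⟨m + m', by ring, fun i hi => by simp [hm i hi, hm' i hi]⟩
  smul_mem' := by
    rintro c _ ⟨m, rfl, hm⟩
    exact ⟨c • m, by rw [mul_smul_comm], fun i hi => by simp [hm i hi]⟩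

lemma coeff_C_mul (r : R) (p : R[T;T⁻¹]) (i : ℤ) : (C r * p).coeff i = r * p.coeff i := by
  rw [← smul_eq_C_mul]; rfl

lemma rep_mem (a x h : R) (ev : ℤ → R →ₐ[k] k) (ha : ∀ i, ev i a = 1) (hx : ∀ i, ev i x = -i)
    (n : ℕ) (D : Derivation k k[T;T⁻¹] k[T;T⁻¹]) (f : R[T;T⁻¹]) (hf : f ∈ filt k h ev n) :
    rep k a x D f ∈ filt k h ev n := by
  obtain ⟨m, rfl, -⟩ := hf
  refine ⟨rep k a x D m, rep_C_mul .., fun i _ => ?_⟩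
  have : rep k a x D m = eulerLin R (bc k R (sym D) * m) + C x * (bc k R (sym D) * m)
      + C (a - 1) * (eulerLin R (bc k R (sym D)) * m) := by
    rw [rep_apply, euler_mul, map_sub, map_one]; ring
  rw [this]
  simp only [AddMonoidAlgebra.coeff_add, Finsupp.add_apply, coeff_euler, coeff_C_mul]
  simp only [map_add, map_mul, map_sub, map_one, map_intCast, ha, hx]
  ring

/-- The action of the enveloping algebra. -/
def act (k : Type*) [Field k] {R : Type*} [CommRing R] [Algebra k R] (a x : R) : UniversalEnvelopingAlgebra k (Derivation k k[T;T⁻¹] k[T;T⁻¹]) →ₐ[k]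
    Module.End k R[T;T⁻¹] := UniversalEnvelopingAlgebra.lift k (rep k a x)

lemma act_ι (a x : R) (D : Derivation k k[T;T⁻¹] k[T;T⁻¹]) :
    act k a x (UniversalEnvelopingAlgebra.ι k D) = rep k a x D :=
  UniversalEnvelopingAlgebra.lift_ι_apply ..

lemma act_mem (a x h : R) (ev : ℤ → R →ₐ[k] k) (ha : ∀ i, ev i a = 1) (hx : ∀ i, ev i x = -i)
    (n : ℕ) (u : UniversalEnvelopingAlgebra k (Derivation k k[T;T⁻¹] k[T;T⁻¹])) :
    ∀ f ∈ filt k h ev n, act k a x u f ∈ filt k h ev n := by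
  obtain ⟨t, rfl⟩ : ∃ t, UniversalEnvelopingAlgebra.mkAlgHom k _ t = u := Quotient.exists_rep u
  induction t using TensorAlgebra.induction with
  | algebraMap r =>
    intro f hf
    rw [AlgHom.commutes, AlgHom.commutes, Module.algebraMap_end_apply]
    exact Submodule.smul_mem _ _ hf
  | ι D =>
    intro f hf
    rw [← UniversalEnvelopingAlgebra.ι_apply, act_ι]
    exact rep_mem a x h ev ha hx n D f hf
  | mul p q hp hq =>
    intro f hf
    rw [map_mul, map_mul]
    exact hp _ (hq _ hf)
  | add p q hp hq =>
    intro f hf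
    rw [map_add, map_add]
    exact Submodule.add_mem _ (hp _ hf) (hq _ hf)

/-- The ascending chain of left ideals. -/
def chain (a x h : R) (ev : ℤ → R →ₐ[k] k) (ha : ∀ i, ev i a = 1) (hx : ∀ i, ev i x = -i)
    (n : ℕ) : Submodule (UniversalEnvelopingAlgebra k (Derivation k k[T;T⁻¹] k[T;T⁻¹]))
      (UniversalEnvelopingAlgebra k (Derivation k k[T;T⁻¹] k[T;T⁻¹])) where
  carrier := {u | act k a x u 1 ∈ filt k h ev n}
  zero_mem' := by
    show act k a x 0 1 ∈ filt k h ev n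
    rw [map_zero]; exact Submodule.zero_mem _
  add_mem' := by
    intro u v hu hv
    show act k a x (u + v) 1 ∈ filt k h ev n
    rw [map_add]; exact Submodule.add_mem _ hu hv
  smul_mem' := by
    intro c u hu
    show act k a x (c * u) 1 ∈ filt k h ev n
    rw [map_mul]; exact act_mem a x h ev ha hx n c _ hu

lemma mem_chain (a x h : R) (ev : ℤ → R →ₐ[k] k) (ha : ∀ i, ev i a = 1) (hx : ∀ i, ev i x = -i)
    (n : ℕ) (u) : u ∈ chain a x h ev ha hx n ↔ act k a x u 1 ∈ filt k h ev n := Iff.rfl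

lemma exists_u (a x : R) (n : ℤ) :
    ∃ u : UniversalEnvelopingAlgebra k (Derivation k k[T;T⁻¹] k[T;T⁻¹]),
      act k a x u 1 = C (2 * (a * (1 - a))) * T n := by
  let b : ℤ → UniversalEnvelopingAlgebra k (Derivation k k[T;T⁻¹] k[T;T⁻¹]) := fun j =>
    UniversalEnvelopingAlgebra.ι k (e k (n - j)) * UniversalEnvelopingAlgebra.ι k (e k j)
  have hb : ∀ j, act k a x (b j) 1 = C ((x + j * a) * (x + j + (n - j) * a)) * T n := by
    intro j
    rw [map_mul, Module.End.mul_apply, act_ι, act_ι, ← T_zero, rep_e, rep_C_mul, add_zero, rep_e,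
      sub_add_cancel, ← mul_assoc, ← map_mul]
    push_cast
    rw [add_zero]
  refine ⟨b 1 + b (-1) - b 0 - b 0, ?_⟩
  rw [map_sub, map_sub, map_add, LinearMap.sub_apply, LinearMap.sub_apply, LinearMap.add_apply,
    hb, hb, hb, ← add_mul, ← sub_mul, ← sub_mul, ← map_add, ← map_sub, ← map_sub]
  congr 2
  push_cast
  ring

theorem main (a x : R) (ev : ℤ → R →ₐ[k] k) (ha : ∀ i, ev i a = 1) (hx : ∀ i, ev i x = -i)
    (hreg : ∀ r : R, 2 * (a * (1 - a)) * r = 2 * (a * (1 - a)) → r = 1) :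
    ¬ IsNoetherianRing (UniversalEnvelopingAlgebra k (Derivation k k[T;T⁻¹] k[T;T⁻¹])) := by
  intro hN
  have hmono : Monotone (chain a x (2 * (a * (1 - a))) ev ha hx) := by
    rintro p q hpq u ⟨m, hm, hm'⟩
    exact ⟨m, hm, fun i hi => hm' i (le_trans (by exact_mod_cast hpq) hi)⟩
  obtain ⟨n, hn⟩ := monotone_stabilizes_iff_noetherian.mpr hN ⟨_, hmono⟩
  obtain ⟨u, hu⟩ := exists_u (k := k) a x n
  have h1 : u ∈ chain a x (2 * (a * (1 - a))) ev ha hx (n + 1) := by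
    refine ⟨T n, hu, fun i hi => ?_⟩
    rw [T_apply, if_neg (by push_cast at hi; omega), map_zero]
  have h2 : u ∈ chain a x (2 * (a * (1 - a))) ev ha hx n := by
    have := hn (n + 1) (Nat.le_succ n)
    simp only [OrderHom.coe_mk] at this
    rw [this]; exact h1
  obtain ⟨m, hm, hm'⟩ := h2
  have h3 := congrArg (fun p => p.coeff (n : ℤ)) (hu.symm.trans hm)
  simp only [coeff_C_mul, T_apply, if_true, mul_one] at h3
  have h4 := hm' n le_rfl
  rw [hreg _ h3.symm, map_one] at h4
  exact one_ne_zero h4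

end

end WittNN

/-- Sierra–Walton: the universal enveloping algebra of the Witt algebra
(the Lie algebra of derivations of the Laurent polynomial ring) over a
field of characteristic `0` is not noetherian. -/
theorem witt_enveloping_not_noetherian
    (k : Type*) [Field k] [CharZero k] :
    ¬ IsNoetherianRing
      (UniversalEnvelopingAlgebra k
        (Derivation k (LaurentPolynomial k) (LaurentPolynomial k))) := by
  refine WittNN.main (R := MvPolynomial (Fin 2) k) (MvPolynomial.X 0) (MvPolynomial.X 1)
    (fun i => MvPolynomial.aeval ![1, -(i : k)]) (by simp) (by simp) ?_
  intro r hr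
  refine mul_left_cancel₀ ?_ (hr.trans (mul_one _).symm)
  intro h0
  have := congrArg (MvPolynomial.aeval (fun _ : Fin 2 => (2 : k))) h0
  simp at this
  norm_num at this
end

section
/- Let k be a field and let G be a polycyclic-by-finite group; that is, G has a subgroup of finite index that is solvable, and every subgroup of G is finitely generated. Then the group algebra kG is a noetherian ring. -/
theorem pbf_hilbert {A : Type*} [Ring A] (R : Subring A) [IsNoetherianRing R] (x : Aˣ)
    (h1 : ∀ r ∈ R, (x : A) * r * (x⁻¹ : Aˣ) ∈ R) (h2 : ∀ r ∈ R, ((x⁻¹ : Aˣ) : A) * r * x ∈ R)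
    (hspan : ∀ a : A, a ∈ AddSubgroup.closure {y : A | ∃ r ∈ R, ∃ n : ℤ, y = r * ((x ^ n : Aˣ) : A)}) :
    IsNoetherianRing A := by
  have c1 : ∀ n : ℕ, ∀ r ∈ R, ∃ r' ∈ R, (x : A) ^ n * r = r' * (x : A) ^ n := by
    intro n
    induction n with
    | zero => intro r hr; exact ⟨r, hr, by simp⟩
    | succ n ih =>
      intro r hr
      obtain ⟨r', hr', e⟩ := ih r hr
      refine ⟨_, h1 r' hr', ?_⟩
      rw [pow_succ', mul_assoc, e]
      simp [mul_assoc]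
  have c2 : ∀ n : ℕ, ∀ r ∈ R, ∃ r' ∈ R, r * (x : A) ^ n = (x : A) ^ n * r' := by
    intro n
    induction n with
    | zero => intro r hr; exact ⟨r, hr, by simp⟩
    | succ n ih =>
      intro r hr
      obtain ⟨r', hr', e⟩ := ih r hr
      refine ⟨_, h2 r' hr', ?_⟩
      rw [pow_succ, ← mul_assoc, e]
      simp [mul_assoc]
  let P : ℕ → Submodule R A := fun n => Submodule.span R ((fun i : ℕ => (x : A) ^ i) '' Set.Iio n)
  have Pmono : Monotone P := fun a b hab =>
    Submodule.span_mono (Set.image_mono (Set.Iio_subset_Iio hab))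
  have Pmem : ∀ n i, i < n → ∀ r ∈ R, r * (x : A) ^ i ∈ P n := by
    intro n i hi r hr
    exact (P n).smul_mem (⟨r, hr⟩ : R) (Submodule.subset_span ⟨i, hi, rfl⟩)
  have Px : ∀ n, ∀ p ∈ P n, (x : A) * p ∈ P (n + 1) := by
    intro n p hp
    induction hp using Submodule.span_induction with
    | mem y hy =>
      obtain ⟨i, hi, rfl⟩ := hy
      have := Pmem (n + 1) (i + 1) (by have : i < n := hi; omega) 1 R.one_mem
      simpa [pow_succ'] using this
    | zero => simp
    | add a b _ _ ha hb => rw [mul_add]; exact add_mem ha hb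
    | smul r y _ hy =>
      obtain ⟨r', hr', e⟩ := c1 1 r r.2
      have := (P (n + 1)).smul_mem (⟨r', hr'⟩ : R) hy
      have e2 : (x : A) * (r • y) = (⟨r', hr'⟩ : R) • ((x : A) * y) := by
        simp only [pow_one] at e
        simp only [Subring.smul_def, smul_eq_mul]
        rw [← mul_assoc, e, mul_assoc]
      rw [e2]; exact this
  have Pxk : ∀ m n, ∀ p ∈ P n, (x : A) ^ m * p ∈ P (n + m) := by
    intro m
    induction m with
    | zero => intro n p hp; simpa using hp
    | succ m ih =>
      intro n p hp
      rw [pow_succ', mul_assoc]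
      exact Px _ _ (ih n p hp)
  have Psucc : ∀ n, ∀ p ∈ P (n + 1), ∃ r ∈ R, ∃ q ∈ P n, p = (x : A) ^ n * r + q := by
    intro n p hp
    have : P (n + 1) = Submodule.span R {(x : A) ^ n} ⊔ P n := by
      have : Set.Iio (n + 1) = insert n (Set.Iio n) := by
        ext i; simp; try omega
      simp only [P]
      rw [this, Set.image_insert_eq, Submodule.span_insert]
    rw [this, Submodule.mem_sup] at hp
    obtain ⟨y, hy, q, hq, rfl⟩ := hp
    obtain ⟨s, rfl⟩ := Submodule.mem_span_singleton.1 hy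
    obtain ⟨r', hr', e⟩ := c2 n s s.2
    exact ⟨r', hr', q, hq, by rw [← e]; rfl⟩
  have Pall : ∀ a : A, ∃ m n : ℕ, (x : A) ^ m * a ∈ P n := by
    intro a
    induction hspan a using AddSubgroup.closure_induction with
    | mem y hy =>
      obtain ⟨r, hr, n, rfl⟩ := hy
      obtain ⟨r', hr', e⟩ := c1 n.natAbs r hr
      refine ⟨n.natAbs, (n.natAbs + n).toNat + 1, ?_⟩
      rw [← mul_assoc, e, mul_assoc]
      have e2 : (x : A) ^ n.natAbs * ((x ^ n : Aˣ) : A) = (x : A) ^ (n.natAbs + n).toNat := by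
        rw [← Units.val_pow_eq_pow_val, ← Units.val_pow_eq_pow_val, ← Units.val_mul,
          ← zpow_natCast, ← zpow_natCast, ← zpow_add]
        congr 2
        omega
      rw [e2]
      exact Pmem _ _ (by omega) _ hr'
    | zero => exact ⟨0, 0, by simp⟩
    | add a b _ _ ha hb =>
      obtain ⟨m, n, h⟩ := ha
      obtain ⟨m', n', h'⟩ := hb
      refine ⟨m + m', (n + m') + (n' + m), ?_⟩
      rw [mul_add]
      refine add_mem ?_ ?_
      · rw [add_comm m, pow_add, mul_assoc]
        exact Pmono (by omega) (Pxk m' _ _ h)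
      · rw [pow_add, mul_assoc]
        exact Pmono (by omega) (Pxk m _ _ h')
    | neg a _ ha =>
      obtain ⟨m, n, h⟩ := ha
      exact ⟨m, n, by rw [mul_neg]; exact neg_mem h⟩
  rw [isNoetherianRing_iff_ideal_fg]
  intro I
  let L : ℕ →o Ideal R :=
    { toFun := fun n =>
        { carrier := {r | ∃ p ∈ P n, (x : A) ^ n * r + p ∈ I}
          zero_mem' := ⟨0, zero_mem _, by simp⟩
          add_mem' := by
            rintro a b ⟨p, hp, h⟩ ⟨q, hq, h'⟩
            refine ⟨p + q, add_mem hp hq, ?_⟩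
            have := add_mem h h'
            convert this using 1
            push_cast
            rw [mul_add]; abel
          smul_mem' := by
            rintro s r ⟨p, hp, h⟩
            obtain ⟨s', hs', e⟩ := c1 n s s.2
            refine ⟨s' * p, (P n).smul_mem (⟨s', hs'⟩ : R) hp, ?_⟩
            have := I.mul_mem_left s' h
            convert this using 1
            simp only [smul_eq_mul, Subring.coe_mul]
            rw [mul_add, ← mul_assoc, ← mul_assoc, e] }
      monotone' := by
        refine monotone_nat_of_le_succ ?_
        rintro n r ⟨p, hp, h⟩
        refine ⟨x * p, Px _ _ hp, ?_⟩
        have := I.mul_mem_left x h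
        rwa [mul_add, ← mul_assoc, ← pow_succ'] at this }
  have Lmem : ∀ n (r : R), r ∈ L n ↔ ∃ p ∈ P n, (x : A) ^ n * r + p ∈ I := fun n r => Iff.rfl
  obtain ⟨N, hN⟩ := monotone_stabilizes_iff_noetherian.2 (inferInstance : IsNoetherian R R) L
  let J : Submodule R A := I.restrictScalars R ⊓ P (N + 1)
  have hPfg : (P (N + 1)).FG := Submodule.fg_span ((Set.finite_Iio _).image _)
  have hPn : IsNoetherian R (P (N + 1)) := isNoetherian_of_fg_of_noetherian _ hPfg
  have hJfg : J.FG := by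
    have := isNoetherian_of_le (inf_le_right : J ≤ P (N + 1))
    exact Submodule.fg_top J |>.1 (this.noetherian ⊤)
  obtain ⟨T, hT⟩ := hJfg
  refine ⟨T, ?_⟩
  have hJ : ∀ a ∈ J, a ∈ Ideal.span (T : Set A) := by
    intro a ha
    rw [← hT] at ha
    induction ha using Submodule.span_induction with
    | mem y hy => exact Ideal.subset_span hy
    | zero => simp
    | add a b _ _ ha hb => exact add_mem ha hb
    | smul r y _ hy => exact Ideal.mul_mem_left _ (r : A) hy
  have hle : Ideal.span (T : Set A) ≤ I := by
    rw [Ideal.span_le]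
    intro t ht
    have : t ∈ J := hT ▸ Submodule.subset_span ht
    exact this.1
  refine le_antisymm hle ?_
  have key : ∀ n, ∀ a ∈ I, a ∈ P n → a ∈ Ideal.span (T : Set A) := by
    intro n
    induction n with
    | zero => intro a ha hp; exact hJ a ⟨ha, Pmono (Nat.zero_le _) hp⟩
    | succ n ih =>
      intro a ha hp
      rcases le_or_gt n N with hn | hn
      · exact hJ a ⟨ha, Pmono (by omega) hp⟩
      obtain ⟨r, hr, q, hq, rfl⟩ := Psucc n a hp
      have hL : (⟨r, hr⟩ : R) ∈ L n := (Lmem _ _).2 ⟨q, hq, ha⟩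
      rw [← hN n hn.le] at hL
      obtain ⟨p, hp', hI⟩ := (Lmem _ _).1 hL
      have hg : (x : A) ^ N * r + p ∈ Ideal.span (T : Set A) := by
        refine hJ _ ⟨hI, add_mem ?_ (Pmono (by omega) hp')⟩
        obtain ⟨r', hr', e⟩ := c1 N r hr
        rw [e]
        exact Pmem _ _ (by omega) _ hr'
      have hg2 := Ideal.mul_mem_left _ ((x : A) ^ (n - N)) hg
      have e : (x : A) ^ n * r + q
          = (x : A) ^ (n - N) * ((x : A) ^ N * r + p) + (q - (x : A) ^ (n - N) * p) := by
        rw [mul_add, ← mul_assoc, ← pow_add, Nat.sub_add_cancel hn.le]; abel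
      rw [e]
      refine add_mem hg2 (ih _ ?_ ?_)
      · have := sub_mem ha (hle hg2)
        rw [e] at this
        simpa using this
      · refine sub_mem hq ?_
        have := Pxk (n - N) _ _ hp'
        rwa [Nat.add_sub_cancel' hn.le] at this
  intro a ha
  obtain ⟨m, n, h⟩ := Pall a
  have := Ideal.mul_mem_left _ (((x⁻¹ : Aˣ) : A) ^ m) (key n _ (I.mul_mem_left _ ha) h)
  rw [← mul_assoc, ← Units.val_pow_eq_pow_val, ← Units.val_pow_eq_pow_val, ← Units.val_mul] at this
  simpa using this

theorem pbf_finite {A : Type*} [Ring A] (R : Subring A) [IsNoetherianRing R] (T : Set A)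
    (hT : T.Finite) (h : Submodule.span R T = ⊤) : IsNoetherianRing A := by
  have : IsNoetherian R A := by
    have : Module.Finite R A := ⟨h ▸ Submodule.fg_span hT⟩
    infer_instance
  exact isNoetherian_of_tower R this

theorem pbf_range {R A : Type*} [Ring R] [Ring A] [IsNoetherianRing R] (f : R →+* A) :
    IsNoetherianRing f.range :=
  isNoetherianRing_of_surjective _ _ f.rangeRestrict f.rangeRestrict_surjective

theorem pbf_single (k : Type*) [Field k] {K H : Type*} [Group K] [Group H] (f : K →* H)
    (a : K) (c : k) :
    MonoidAlgebra.single (f a) c ∈ (MonoidAlgebra.mapDomainRingHom k f).range :=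
  ⟨MonoidAlgebra.single a c, by simp⟩

theorem pbf_conj (k : Type*) [Field k] {K H : Type*} [Group K] [Group H] (f : K →* H) (g : H)
    (h1 : ∀ a, ∃ b, g * f a * g⁻¹ = f b) (r : MonoidAlgebra k H)
    (hr : r ∈ (MonoidAlgebra.mapDomainRingHom k f).range) :
    MonoidAlgebra.single g 1 * r * MonoidAlgebra.single g⁻¹ 1
      ∈ (MonoidAlgebra.mapDomainRingHom k f).range := by
  obtain ⟨r, rfl⟩ := hr
  induction r using MonoidAlgebra.induction_linear with
  | zero => simp
  | add a b ha hb => rw [map_add, mul_add, add_mul]; exact add_mem ha hb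
  | single a c =>
    obtain ⟨b, hb⟩ := h1 a
    simp only [MonoidAlgebra.mapDomainRingHom_apply, MonoidAlgebra.mapDomain_single,
      MonoidAlgebra.single_mul_single, one_mul, mul_one]
    rw [hb]
    exact pbf_single k f b c

theorem pbf_step (k : Type*) [Field k] {K H : Type*} [Group K] [Group H] (f : K →* H) (g : H)
    (h1 : ∀ a, ∃ b, g * f a * g⁻¹ = f b) (h2 : ∀ a, ∃ b, g⁻¹ * f a * g = f b)
    (h : ∀ y : H, ∃ a, ∃ n : ℤ, y = f a * g ^ n) (hK : IsNoetherianRing (MonoidAlgebra k K)) :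
    IsNoetherianRing (MonoidAlgebra k H) := by
  have := pbf_range (MonoidAlgebra.mapDomainRingHom k f)
  let x : (MonoidAlgebra k H)ˣ := Units.map (MonoidAlgebra.of k H) (toUnits g)
  have hx : ∀ n : ℤ, ((x ^ n : (MonoidAlgebra k H)ˣ) : MonoidAlgebra k H)
      = MonoidAlgebra.single (g ^ n) 1 := by
    intro n
    have : x ^ n = Units.map (MonoidAlgebra.of k H) (toUnits (g ^ n)) := by
      rw [map_zpow, map_zpow]
    rw [this]
    rfl
  have hx1 : (x : MonoidAlgebra k H) = MonoidAlgebra.single g 1 := by simpa using hx 1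
  have hx2 : ((x⁻¹ : (MonoidAlgebra k H)ˣ) : MonoidAlgebra k H) = MonoidAlgebra.single g⁻¹ 1 := by
    simpa using hx (-1)
  refine pbf_hilbert (MonoidAlgebra.mapDomainRingHom k f).range x ?_ ?_ ?_
  · intro r hr
    rw [hx1, hx2]
    exact pbf_conj k f g h1 r hr
  · intro r hr
    rw [hx1, hx2]
    simpa using pbf_conj k f g⁻¹ (by simpa using h2) r hr
  · intro a
    induction a using MonoidAlgebra.induction_linear with
    | zero => exact zero_mem _
    | add a b ha hb => exact add_mem ha hb
    | single y c =>
      obtain ⟨a, n, rfl⟩ := h y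
      refine AddSubgroup.subset_closure ⟨_, pbf_single k f a c, n, ?_⟩
      rw [hx, MonoidAlgebra.single_mul_single, mul_one]

theorem pbf_index (k : Type*) [Field k] {G : Type*} [Group G] (N : Subgroup G) [N.FiniteIndex]
    (hK : IsNoetherianRing (MonoidAlgebra k N)) : IsNoetherianRing (MonoidAlgebra k G) := by
  have := pbf_range (MonoidAlgebra.mapDomainRingHom k N.subtype)
  have : Finite (G ⧸ N) := Subgroup.finite_quotient_of_finiteIndex
  refine pbf_finite (MonoidAlgebra.mapDomainRingHom k N.subtype).range
    (Set.range fun q : G ⧸ N => MonoidAlgebra.single (q.out)⁻¹ 1) (Set.finite_range _) ?_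
  rw [eq_top_iff]
  rintro a -
  induction a using MonoidAlgebra.induction_linear with
  | zero => exact zero_mem _
  | add a b ha hb => exact add_mem ha hb
  | single y c =>
    obtain ⟨n, hn⟩ := QuotientGroup.mk_out_eq_mul N y⁻¹
    have := Submodule.smul_mem (Submodule.span (MonoidAlgebra.mapDomainRingHom k N.subtype).range
      (Set.range fun q : G ⧸ N => (MonoidAlgebra.single (q.out)⁻¹ 1 : MonoidAlgebra k G)))
      (⟨_, pbf_single k N.subtype n c⟩ : (MonoidAlgebra.mapDomainRingHom k N.subtype).range)
      (Submodule.subset_span ⟨(y⁻¹ : G), rfl⟩)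
    convert this using 1
    simp only [Subring.smul_def, smul_eq_mul]
    rw [hn, MonoidAlgebra.single_mul_single]
    simp

theorem pbf_layer (k : Type*) [Field k] {G : Type*} [Group G] (D : Subgroup G)
    (hfg : D.FG) (hK : IsNoetherianRing (MonoidAlgebra k ↥⁅D, D⁆)) :
    IsNoetherianRing (MonoidAlgebra k D) := by
  classical
  obtain ⟨S, hS⟩ := hfg
  have key : ∀ T : Finset G, (T : Set G) ⊆ D →
      IsNoetherianRing (MonoidAlgebra k ↥(⁅D, D⁆ ⊔ Subgroup.closure (T : Set G))) := by
    intro T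
    induction T using Finset.induction_on with
    | empty =>
      intro _
      have : ⁅D, D⁆ ⊔ Subgroup.closure ((∅ : Finset G) : Set G) = ⁅D, D⁆ := by simp
      rw [this]; exact hK
    | insert g T _ ih =>
      intro hT
      rw [Finset.coe_insert, Set.insert_subset_iff] at hT
      obtain ⟨hg, hT⟩ := hT
      have ih := ih hT
      have e : ⁅D, D⁆ ⊔ Subgroup.closure ((insert g T : Finset G) : Set G)
          = (⁅D, D⁆ ⊔ Subgroup.closure (T : Set G)) ⊔ Subgroup.zpowers g := by
        rw [Finset.coe_insert, Set.insert_eq, Subgroup.closure_union, Subgroup.zpowers_eq_closure,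
          sup_assoc, sup_comm (Subgroup.closure {g})]
      rw [e]
      generalize hKd : ⁅D, D⁆ ⊔ Subgroup.closure (T : Set G) = K at ih
      have hDK : ⁅D, D⁆ ≤ K := hKd ▸ le_sup_left
      have hKD : K ≤ D := by
        rw [← hKd]
        exact sup_le (Subgroup.commutator_le_self D) ((Subgroup.closure_le _).2 hT)
      have hconj : ∀ y ∈ D, ∀ a ∈ K, y * a * y⁻¹ ∈ K := by
        intro y hy a ha
        have h := K.mul_mem (hDK (Subgroup.commutator_mem_commutator hy (hKD ha))) ha
        simpa [commutatorElement_def] using h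
      have hgn : Subgroup.zpowers g ≤ Subgroup.normalizer (K : Set G) := by
        rw [Subgroup.zpowers_le, Subgroup.mem_normalizer_iff]
        intro a
        refine ⟨hconj g hg a, fun h => ?_⟩
        have := hconj g⁻¹ (D.inv_mem hg) _ h
        simpa [mul_assoc] using this
      refine pbf_step k (Subgroup.inclusion (le_sup_left : K ≤ K ⊔ Subgroup.zpowers g))
        ⟨g, Subgroup.mem_sup_right (Subgroup.mem_zpowers g)⟩ ?_ ?_ ?_ ih
      · rintro ⟨a, ha⟩
        exact ⟨⟨_, hconj g hg a ha⟩, rfl⟩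
      · rintro ⟨a, ha⟩
        have := hconj g⁻¹ (D.inv_mem hg) a ha
        rw [inv_inv] at this
        exact ⟨⟨_, this⟩, rfl⟩
      · rintro ⟨y, hy⟩
        have hy' : y ∈ ((K ⊔ Subgroup.zpowers g : Subgroup G) : Set G) := hy
        rw [Subgroup.coe_mul_of_right_le_normalizer_left _ _ hgn] at hy'
        obtain ⟨a, ha, z, ⟨n, rfl⟩, rfl⟩ := hy'
        exact ⟨⟨a, ha⟩, n, rfl⟩
  have h := key S (hS ▸ Subgroup.subset_closure)
  rw [hS, sup_eq_right.2 (Subgroup.commutator_le_self D)] at h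
  exact h

theorem pbf_solvable (k : Type*) [Field k] {G : Type*} [Group G] [Group.IsSolvable G]
    (hmax : ∀ H : Subgroup G, H.FG) : IsNoetherianRing (MonoidAlgebra k G) := by
  obtain ⟨n, hn⟩ := Group.IsSolvable.solvable (G := G)
  have key : ∀ m, m ≤ n → IsNoetherianRing (MonoidAlgebra k (derivedSeries G (n - m))) := by
    intro m
    induction m with
    | zero =>
      intro _
      rw [Nat.sub_zero, hn]
      have : IsNoetherianRing k := inferInstance
      exact isNoetherianRing_of_surjective k _
        (MonoidAlgebra.singleOneRingHom (R := k) (M := (⊥ : Subgroup G))) (by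
          intro a
          induction a using MonoidAlgebra.induction_linear with
          | zero => exact ⟨0, map_zero _⟩
          | add a b ha hb =>
            obtain ⟨u, rfl⟩ := ha
            obtain ⟨v, rfl⟩ := hb
            exact ⟨u + v, map_add _ _ _⟩
          | single y c => exact ⟨c, by rw [Subsingleton.elim y 1]; rfl⟩)
    | succ m ih =>
      intro hm
      refine pbf_layer k _ (hmax _) ?_
      have h := ih (by omega)
      have e : n - m = (n - (m + 1)) + 1 := by omega
      rw [e, derivedSeries_succ] at h
      exact h
  have h := key n le_rfl
  rw [Nat.sub_self, derivedSeries_zero] at h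
  exact pbf_index k ⊤ h

/-- P. Hall: the group algebra of a polycyclic-by-finite group is noetherian. -/
theorem monoidAlgebra_isNoetherianRing_of_polycyclicByFinite
    (k : Type*) [Field k] (G : Type*) [Group G]
    (hsolv : ∃ N : Subgroup G, N.FiniteIndex ∧ IsSolvable N)
    (hmax : ∀ H : Subgroup G, H.FG) :
    IsNoetherianRing (MonoidAlgebra k G) := by
  obtain ⟨N, hN, hs⟩ := hsolv
  have hs' : Group.IsSolvable N := hs
  refine pbf_index k N (pbf_solvable k fun H => ?_)
  have h := (Group.fg_iff_subgroup_fg _).2 (hmax (H.map N.subtype))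
  rw [← Group.fg_iff_subgroup_fg]
  have e := H.equivMapOfInjective N.subtype N.subtype_injective
  exact Group.fg_of_surjective (f := e.symm.toMonoidHom) e.symm.surjective
end

section
/- Let k be a field and G a group. If the group algebra kG is a noetherian ring, then G satisfies Max; that is, every subgroup of G is finitely generated. -/
/-- If the group algebra `kG` is noetherian then `G` satisfies Max:
every subgroup of `G` is finitely generated. -/
theorem subgroup_fg_of_monoidAlgebra_isNoetherianRing
    (k : Type*) [Field k] (G : Type*) [Group G]
    (h : IsNoetherianRing (MonoidAlgebra k G)) :
    ∀ H : Subgroup G, H.FG := by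
  classical
  intro H
  let f : G → MonoidAlgebra k G := fun g => MonoidAlgebra.of k G g - 1
  obtain ⟨s, hs, hspan⟩ := (Submodule.fg_span_iff_fg_span_finset_subset
    (R := MonoidAlgebra k G) (f '' (H : Set G))).1 (IsNoetherian.noetherian _)
  obtain ⟨t, ht, rfl⟩ := Finset.subset_set_image_iff.1 hs
  refine ⟨t, le_antisymm ((Subgroup.closure_le _).2 ht) ?_⟩
  intro g hg
  set K := Subgroup.closure (t : Set G) with hK
  let ρ := (Representation.ofMulAction k G (G ⧸ K)).asAlgebraHom
  let x : MonoidAlgebra k (G ⧸ K) := MonoidAlgebra.single ((1 : G) : G ⧸ K) 1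
  let I : Submodule (MonoidAlgebra k G) (MonoidAlgebra k G) :=
    { carrier := {a | ρ a x = 0}
      zero_mem' := by simp
      add_mem' := by
        intro a b ha hb
        simp only [Set.mem_ofPred_eq] at *
        rw [map_add, LinearMap.add_apply, ha, hb, add_zero]
      smul_mem' := by
        intro c a ha
        simp only [Set.mem_ofPred_eq, smul_eq_mul] at *
        rw [map_mul, Module.End.mul_apply, ha, map_zero] }
  have key : ∀ a : G, f a ∈ I ↔ a ∈ K := by
    intro a
    change ρ (MonoidAlgebra.of k G a - 1) x = 0 ↔ _
    have h1 : ρ (MonoidAlgebra.of k G a) x = MonoidAlgebra.single ((a : G) : G ⧸ K) 1 := by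
      simp only [ρ, x, Representation.asAlgebraHom_of, Representation.ofMulAction_single]
      rw [MulAction.Quotient.smul_coe, smul_eq_mul, mul_one]
    rw [map_sub, LinearMap.sub_apply, h1, map_one, Module.End.one_apply, sub_eq_zero,
      MonoidAlgebra.single_left_inj one_ne_zero, eq_comm, QuotientGroup.eq]
    simp
  rw [← key]
  have hle : Submodule.span (MonoidAlgebra k G) (f '' (H : Set G)) ≤ I := by
    rw [hspan, Submodule.span_le]
    intro y hy
    obtain ⟨a, ha, rfl⟩ := Finset.mem_image.1 (Finset.mem_coe.1 hy)
    exact (key a).2 (Subgroup.subset_closure ha)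
  exact hle (Submodule.subset_span ⟨g, hg, rfl⟩)
end

section
/- Let k be a field and let F be a free group of rank 2. Then the group algebra kF is a finitely generated (affine) k-algebra, but kF is not a noetherian ring. -/
namespace FreeTwo

/-- Shift on the first factor. -/
noncomputable def A (k : Type*) [Field k] :
    ((ℤ →₀ k) × (ℤ →₀ k)) ≃ₗ[k] ((ℤ →₀ k) × (ℤ →₀ k)) :=
  LinearEquiv.prodCongr (Finsupp.domLCongr (Equiv.addRight (1 : ℤ))) (LinearEquiv.refl k _)

/-- Transvection `(u, w) ↦ (u, w + u)`. -/
noncomputable def B (k : Type*) [Field k] :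
    ((ℤ →₀ k) × (ℤ →₀ k)) ≃ₗ[k] ((ℤ →₀ k) × (ℤ →₀ k)) where
  toFun p := (p.1, p.2 + p.1)
  invFun p := (p.1, p.2 - p.1)
  map_add' p q := by ext <;> simp; ring
  map_smul' c p := by ext <;> simp
  left_inv p := by simp
  right_inv p := by simp

/-- The group action. -/
noncomputable def ρ (k : Type*) [Field k] : FreeGroup (Fin 2) →*
    (((ℤ →₀ k) × (ℤ →₀ k)) ≃ₗ[k] ((ℤ →₀ k) × (ℤ →₀ k))) :=
  FreeGroup.lift ![A k, B k]

/-- The algebra action. -/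
noncomputable def Φ (k : Type*) [Field k] : MonoidAlgebra k (FreeGroup (Fin 2)) →ₐ[k]
    Module.End k ((ℤ →₀ k) × (ℤ →₀ k)) :=
  MonoidAlgebra.lift k _ _
    ((LinearEquiv.automorphismGroup.toLinearMapMonoidHom).comp (ρ k))

theorem Φ_of (k : Type*) [Field k] (g : FreeGroup (Fin 2)) (v) :
    Φ k (MonoidAlgebra.of k _ g) v = ρ k g v := by
  simp [Φ]

theorem ρ_fix (k : Type*) [Field k] (w : ℤ →₀ k) (g : FreeGroup (Fin 2)) :
    ρ k g (0, w) = (0, w) := by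
  have hgen : ∀ i : Fin 2, ρ k (FreeGroup.of i) (0, w) = (0, w) := by
    intro i
    fin_cases i
    · simp [ρ, A]
    · simp [ρ, B]
  induction g using FreeGroup.induction_on with
  | C1 => simp
  | of i => exact hgen i
  | inv_of i _ =>
    rw [map_inv]
    exact (LinearEquiv.symm_apply_eq _).2 (hgen i).symm
  | mul x y hx hy => rw [map_mul, LinearEquiv.mul_apply, hy, hx]

theorem Φ_mem (k : Type*) [Field k] (W : Submodule k ((ℤ →₀ k) × (ℤ →₀ k)))
    (w : ℤ →₀ k) (hw : ((0 : ℤ →₀ k), w) ∈ W) (r : MonoidAlgebra k (FreeGroup (Fin 2))) :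
    Φ k r (0, w) ∈ W := by
  induction r using MonoidAlgebra.induction_on with
  | of g => rw [Φ_of, ρ_fix]; exact hw
  | add f g hf hg => rw [map_add]; exact W.add_mem hf hg
  | smul c f hf => rw [map_smul]; exact W.smul_mem c hf

/-- The chain of subspaces. -/
def W (k : Type*) [Field k] (n : ℕ) : Submodule k ((ℤ →₀ k) × (ℤ →₀ k)) where
  carrier := {p | p.1 = 0 ∧ ∀ m : ℤ, (n : ℤ) ≤ m → p.2 m = 0}
  zero_mem' := by simp
  add_mem' := by
    rintro p q ⟨h1, h2⟩ ⟨h3, h4⟩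
    exact ⟨by simp [h1, h3], fun m hm => by simp [h2 m hm, h4 m hm]⟩
  smul_mem' := by
    rintro c p ⟨h1, h2⟩
    exact ⟨by simp [h1], fun m hm => by simp [h2 m hm]⟩

/-- The chain of left ideals. -/
noncomputable def I (k : Type*) [Field k] (n : ℕ) :
    Ideal (MonoidAlgebra k (FreeGroup (Fin 2))) where
  carrier := {r | Φ k r (Finsupp.single 0 1, 0) ∈ W k n}
  zero_mem' := by simp
  add_mem' := by
    intro r s hr hs
    simp only [Set.mem_ofPred_eq, map_add] at *
    exact (W k n).add_mem hr hs
  smul_mem' := by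
    intro c r hr
    simp only [Set.mem_ofPred_eq, smul_eq_mul, map_mul, Module.End.mul_apply] at *
    rcases h : Φ k r (Finsupp.single 0 1, 0) with ⟨u, w⟩
    rw [h] at hr
    obtain rfl : u = 0 := hr.1
    exact Φ_mem k _ w hr c

theorem ρ_pow (k : Type*) [Field k] (n : ℕ) :
    ρ k (FreeGroup.of 0 ^ n) (Finsupp.single 0 1, 0) = (Finsupp.single (n : ℤ) 1, 0) := by
  induction n with
  | zero => simp
  | succ n ih =>
    rw [pow_succ', map_mul, LinearEquiv.mul_apply, ih]
    simp [ρ, A]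

theorem Φ_x (k : Type*) [Field k] (n : ℕ) :
    Φ k (MonoidAlgebra.of k _ (FreeGroup.of 1 * FreeGroup.of 0 ^ n) -
      MonoidAlgebra.of k _ (FreeGroup.of 0 ^ n)) (Finsupp.single 0 1, 0)
      = (0, Finsupp.single (n : ℤ) 1) := by
  rw [map_sub, LinearMap.sub_apply, Φ_of, Φ_of, map_mul, LinearEquiv.mul_apply, ρ_pow]
  simp [ρ, B]

end FreeTwo

open FreeTwo in
/-- The group algebra of a free group of rank `2` is an affine `k`-algebra
which is not noetherian. -/
theorem monoidAlgebra_freeGroup_two_finiteType_not_noetherian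
    (k : Type*) [Field k] :
    Algebra.FiniteType k (MonoidAlgebra k (FreeGroup (Fin 2))) ∧
      ¬ IsNoetherianRing (MonoidAlgebra k (FreeGroup (Fin 2))) := by
  refine ⟨MonoidAlgebra.finiteType_iff_group_fg.2 inferInstance, fun h => ?_⟩
  have hmono : Monotone (I k) := by
    intro a b hab r hr
    exact ⟨hr.1, fun m hm => hr.2 m (by omega)⟩
  obtain ⟨n, hn⟩ := monotone_stabilizes_iff_noetherian.2 h ⟨I k, hmono⟩
  have h1 : I k n = I k (n + 1) := hn (n + 1) (by omega)
  have h2 : (MonoidAlgebra.of k _ (FreeGroup.of 1 * FreeGroup.of 0 ^ n) -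
      MonoidAlgebra.of k _ (FreeGroup.of 0 ^ n)) ∈ I k (n + 1) := by
    change Φ k _ _ ∈ W k (n + 1)
    rw [Φ_x]
    refine ⟨rfl, fun m hm => ?_⟩
    simp only
    rw [Finsupp.single_apply, if_neg]
    push_cast at hm
    omega
  rw [← h1] at h2
  change Φ k _ _ ∈ W k n at h2
  rw [Φ_x] at h2
  have := h2.2 n le_rfl
  simp at this
end
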